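/- arXiv:0909.0219 — 2 statements merged into one kernel-verified Lean document; each statement's English description precedes it below -/
import Mathlib

section
/- Let x₁ ≤ x₃ < x₄ ≤ x₂ and T > 0 be real numbers. Let u ∈ C¹((x₁,x₂)×[0,T)) be a classical solution of the one-dimensional equation u_t = (φ'(u_x))_x on (x₁,x₂)×[0,T) (i.e., for each (x,t) the map x ↦ φ'(u_x(x,t)) is differentiable in x and u_t(x,t) equals this derivative). Assume |u_x(x,0)| < 1 for every x ∈ (x₃,x₄). Then |u_x(x,t)| < 1 for every (x,t) ∈ (x₃,x₄)×[0,T). -/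
open Set Filter Topology MeasureTheory intervalIntegral

/-- `u` is a `C¹` classical solution of `u_t = (f (u_x))_x` on `[a, b] × [0, τ]`, with `u_x = p` and
`u_t = q`. -/
structure IsClassicalSolutionOn (f : ℝ → ℝ) (u p q : ℝ → ℝ → ℝ) (a b τ : ℝ) : Prop where
  hasDerivAt_space : ∀ x ∈ Icc a b, ∀ t ∈ Icc 0 τ, HasDerivAt (fun y => u y t) (p x t) x
  hasDerivWithinAt_time : ∀ x ∈ Icc a b, ∀ t ∈ Icc 0 τ,
    HasDerivWithinAt (fun s => u x s) (q x t) (Icc 0 τ) t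
  continuousOn_space : ContinuousOn (fun z : ℝ × ℝ => p z.1 z.2) (Icc a b ×ˢ Icc 0 τ)
  continuousOn_time : ContinuousOn (fun z : ℝ × ℝ => q z.1 z.2) (Icc a b ×ˢ Icc 0 τ)
  hasDerivAt_flux : ∀ x ∈ Icc a b, ∀ t ∈ Icc 0 τ, HasDerivAt (fun y => f (p y t)) (q x t) x
  continuousAt_space : ∀ x ∈ Icc a b, ∀ t ∈ Icc 0 τ, ContinuousAt (fun y => p y t) x

/-- The structural properties of the derivative `f = φ'` of a Perona–Malik type potential. -/
structure IsPeronaMalikFlux (f : ℝ → ℝ) : Prop where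
  differentiable : Differentiable ℝ f
  continuous_deriv : Continuous (deriv f)
  odd : ∀ σ, f (-σ) = -f σ
  strictMonoOn : StrictMonoOn f (Icc (-1) 1)
  antitoneOn_Iic : AntitoneOn f (Iic (-1))
  antitoneOn_Ici : AntitoneOn f (Ici 1)

section Slices

variable {a b τ : ℝ} {F : ℝ → ℝ → ℝ}

theorem continuousOn_slice_left (hF : ContinuousOn (fun z : ℝ × ℝ => F z.1 z.2) (Icc a b ×ˢ Icc 0 τ))
    {t : ℝ} (ht : t ∈ Icc 0 τ) : ContinuousOn (fun x => F x t) (Icc a b) :=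
  hF.comp (f := fun x => (x, t)) (by fun_prop) fun _ hx => ⟨hx, ht⟩

theorem continuousOn_slice_right
    (hF : ContinuousOn (fun z : ℝ × ℝ => F z.1 z.2) (Icc a b ×ˢ Icc 0 τ))
    {x : ℝ} (hx : x ∈ Icc a b) : ContinuousOn (fun t => F x t) (Icc 0 τ) :=
  hF.comp (f := fun t => (x, t)) (by fun_prop) fun _ ht => ⟨hx, ht⟩

theorem exists_bound_of_continuousOn_rect
    (hF : ContinuousOn (fun z : ℝ × ℝ => F z.1 z.2) (Icc a b ×ˢ Icc 0 τ)) :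
    ∃ C, 0 ≤ C ∧ ∀ x ∈ Icc a b, ∀ t ∈ Icc 0 τ, |F x t| ≤ C := by
  obtain ⟨C, hC⟩ := (isCompact_Icc.prod isCompact_Icc).exists_bound_of_continuousOn hF
  exact ⟨max C 0, le_max_right _ _, fun x hx t ht => (hC (x, t) ⟨hx, ht⟩).trans (le_max_left _ _)⟩

theorem intervalIntegrable_slice (hab : a ≤ b)
    (hF : ContinuousOn (fun z : ℝ × ℝ => F z.1 z.2) (Icc a b ×ˢ Icc 0 τ))
    {t : ℝ} (ht : t ∈ Icc 0 τ) : IntervalIntegrable (fun x => F x t) volume a b :=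
  (continuousOn_slice_left hF ht).intervalIntegrable_of_Icc hab

theorem continuousOn_integral_slice (hab : a ≤ b)
    (hF : ContinuousOn (fun z : ℝ × ℝ => F z.1 z.2) (Icc a b ×ˢ Icc 0 τ)) :
    ContinuousOn (fun t => ∫ x in a..b, F x t) (Icc 0 τ) := by
  obtain ⟨C, -, hC⟩ := exists_bound_of_continuousOn_rect hF
  intro t ht
  refine continuousWithinAt_of_dominated_interval (bound := fun _ => C) ?_ ?_ (by simp) ?_
  · filter_upwards [self_mem_nhdsWithin] with s hs
    exact (intervalIntegrable_slice hab hF hs).aestronglyMeasurable_restrict_uIoc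
  · filter_upwards [self_mem_nhdsWithin] with s hs
    refine .of_forall fun x hx => hC x ?_ s hs
    rw [uIoc_of_le hab] at hx
    exact Ioc_subset_Icc_self hx
  · refine .of_forall fun x hx => ?_
    rw [uIoc_of_le hab] at hx
    exact continuousOn_slice_right hF (Ioc_subset_Icc_self hx) t ht

end Slices

/-- Truncating the argument of `f` at a local extremum preserves differentiability along `p`. -/
theorem hasDerivAt_comp_max {f p : ℝ → ℝ} {c q x : ℝ} (hf : IsLocalExtr f c)
    (hp : ContinuousAt p x) (hfp : HasDerivAt (fun y => f (p y)) q x) :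
    HasDerivAt (fun y => f (max (p y) c)) (if c < p x then q else 0) x := by
  rcases lt_trichotomy (p x) c with h | h | h
  · rw [if_neg h.not_gt]
    refine (hasDerivAt_const x (f c)).congr_of_eventuallyEq ?_
    filter_upwards [hp.eventually_lt_const h] with y hy
    rw [max_eq_right hy.le]
  · subst h
    have hq : q = 0 := IsLocalExtr.hasDerivAt_eq_zero (f := fun y => f (p y))
      (IsExtrFilter.comp_tendsto (g := p) hf hp) hfp
    subst hq
    rw [if_neg (lt_irrefl _)]
    rw [hasDerivAt_iff_isLittleO] at hfp ⊢
    refine (Asymptotics.isBigO_of_le _ fun y => ?_).trans_isLittleO hfp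
    rcases le_total (p y) (p x) with h | h <;> simp [h]
  · rw [if_pos h]
    refine hfp.congr_of_eventuallyEq ?_
    filter_upwards [hp.eventually_const_lt h] with y hy
    rw [max_eq_left hy.le]

theorem continuousOn_ite_lt {S : Set (ℝ × ℝ)} {p q : ℝ × ℝ → ℝ} {c : ℝ} (hp : ContinuousOn p S)
    (hq : ContinuousOn q S) (h : ∀ z ∈ S, p z = c → q z = 0) :
    ContinuousOn (fun z => if c < p z then q z else 0) S := by
  intro z hz
  rcases lt_trichotomy (p z) c with hc | hc | hc
  · refine (continuousWithinAt_const (b := (0 : ℝ))).congr_of_eventuallyEq ?_ (if_neg hc.not_gt)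
    filter_upwards [(hp z hz).eventually_lt_const hc] with y hy
    exact if_neg hy.not_gt
  · have hq0 := hq z hz
    unfold ContinuousWithinAt at hq0 ⊢
    rw [h z hz hc] at hq0
    simp only [if_neg hc.not_gt]
    refine squeeze_zero_norm (fun y => ?_) (by simpa using hq0.norm)
    split_ifs <;> simp
  · refine (hq z hz).congr_of_eventuallyEq ?_ (if_pos hc)
    filter_upwards [(hp z hz).eventually_const_lt hc] with y hy
    exact if_pos hy

/-- The antiderivative of a monotone function satisfies the inequalities of a convex function. -/
theorem Monotone.integral_sub_le {g : ℝ → ℝ} (hg : Monotone g) (r σ ρ : ℝ) :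
    (∫ y in r..ρ, g y) - ∫ y in r..σ, g y ≤ g ρ * (ρ - σ) := by
  have hi : ∀ c d, IntervalIntegrable g volume c d := fun c d => hg.intervalIntegrable
  rw [integral_interval_sub_left (hi _ _) (hi _ _)]
  rcases le_total σ ρ with h | h
  · have := integral_mono_on h (hi σ ρ) (intervalIntegrable_const (c := g ρ)) fun x hx => hg hx.2
    simpa [mul_comm] using this
  · have := integral_mono_on h (intervalIntegrable_const (c := g ρ)) (hi ρ σ) fun x hx => hg hx.1
    rw [integral_symm]
    simp only [intervalIntegral.integral_const, smul_eq_mul] at this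
    linarith

theorem Monotone.le_integral_sub {g : ℝ → ℝ} (hg : Monotone g) (r σ ρ : ℝ) :
    g σ * (ρ - σ) ≤ (∫ y in r..ρ, g y) - ∫ y in r..σ, g y := by
  have := hg.integral_sub_le r ρ σ
  linarith

/-- A function vanishing at most linearly at an interior point has a non-integrable inverse. -/
theorem not_forall_integral_div_add_le {a b x₀ C : ℝ} {w η : ℝ → ℝ} (hx₀ : x₀ ∈ Ioo a b)
    (hw : ContinuousOn w (Icc a b)) (hw0 : ∀ x ∈ Icc a b, 0 ≤ w x)
    (hη : Continuous η) (hη0 : ∀ x, 0 ≤ η x) (hηx₀ : 0 < η x₀)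
    (hO : w =O[𝓝 x₀] fun x => x - x₀) :
    ¬ ∀ ε ∈ Ioc (0 : ℝ) 1, ∫ x in a..b, η x / (w x + ε) ≤ C := by
  intro hC
  obtain ⟨K, hK, hKO⟩ := hO.exists_pos
  have hm := hη.continuousAt.eventually_const_lt (half_lt_self hηx₀)
  obtain ⟨δ, hδ, hball⟩ := Metric.eventually_nhds_iff.1 (hKO.bound.and hm)
  obtain ⟨d, hd0, hd⟩ : ∃ d, 0 < d ∧ d < min δ (b - x₀) :=
    exists_between (lt_min hδ (sub_pos.2 hx₀.2))
  have hdδ := hd.trans_le (min_le_left _ _)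
  have hdb := hd.trans_le (min_le_right _ _)
  set m := η x₀ / 2 with hm_def
  have hm0 : 0 < m := half_pos hηx₀
  have key : ∀ ε ∈ Ioc (0 : ℝ) 1, m / K * (Real.log (K * d) - Real.log ε) ≤ C := by
    intro ε hε
    have hε0 := hε.1
    have hint : IntervalIntegrable (fun x => η x / (w x + ε)) volume a b :=
      (hη.continuousOn.div (hw.add continuousOn_const) fun x hx =>
        (add_pos_of_nonneg_of_pos (hw0 x hx) hε0).ne').intervalIntegrable_of_Icc (hx₀.1.trans hx₀.2).le
    have hpos : ∀ x ∈ Icc x₀ (x₀ + d), 0 < K * (x - x₀) + ε := fun x hx => by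
      exact add_pos_of_nonneg_of_pos (mul_nonneg hK.le (sub_nonneg.2 hx.1)) hε0
    have hc : ContinuousOn (fun x => m / (K * (x - x₀) + ε)) (Icc x₀ (x₀ + d)) :=
      continuousOn_const.div (by fun_prop) fun x hx => (hpos x hx).ne'
    have hle : x₀ ≤ x₀ + d := by linarith
    have h1 : ∫ x in x₀..x₀ + d, m / (K * (x - x₀) + ε)
        = m / K * (Real.log (K * d + ε) - Real.log ε) := by
      rw [integral_eq_sub_of_hasDerivAt (f := fun x => m / K * Real.log (K * (x - x₀) + ε))]
      · simp; ring
      · intro x hx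
        rw [uIcc_of_le hle] at hx
        have := ((((hasDerivAt_id x).sub_const x₀).const_mul K).add_const ε).log (hpos x hx).ne'
        refine (this.const_mul (m / K)).congr_deriv ?_
        have := (hpos x hx).ne'
        simp only [id]
        field_simp
      · exact hc.intervalIntegrable_of_Icc hle
    have h2 : ∫ x in x₀..x₀ + d, m / (K * (x - x₀) + ε)
        ≤ ∫ x in x₀..x₀ + d, η x / (w x + ε) := by
      refine integral_mono_on hle (hc.intervalIntegrable_of_Icc hle)
        (hint.mono_set ?_) fun x hx => ?_
      · rw [uIcc_of_le hle, uIcc_of_le (hx₀.1.trans hx₀.2).le]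
        exact Icc_subset_Icc hx₀.1.le (by linarith)
      · have hxx : dist x x₀ < δ := by
          rw [Real.dist_eq, abs_of_nonneg (sub_nonneg.2 hx.1)]; linarith [hx.2]
        obtain ⟨hwx, hηx⟩ := hball hxx
        rw [Real.norm_eq_abs, Real.norm_eq_abs, abs_of_nonneg (sub_nonneg.2 hx.1)] at hwx
        have hw0x := hw0 x ⟨hx₀.1.le.trans hx.1, by linarith [hx.2]⟩
        have := le_abs_self (w x)
        have := hwx.trans' this
        gcongr
        exact hη0 x
    have h3 : ∫ x in x₀..x₀ + d, η x / (w x + ε) ≤ ∫ x in a..b, η x / (w x + ε) := by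
      refine integral_mono_interval hx₀.1.le hle (by linarith) ?_ hint
      refine (ae_restrict_iff' measurableSet_Ioc).2 (.of_forall fun x hx => ?_)
      have := hw0 x (Ioc_subset_Icc_self hx)
      have := hη0 x
      simp only [Pi.zero_apply]
      positivity
    have h4 : Real.log (K * d) ≤ Real.log (K * d + ε) :=
      Real.log_le_log (by positivity) (by linarith)
    have h5 : m / K * (Real.log (K * d) - Real.log ε)
        ≤ m / K * (Real.log (K * d + ε) - Real.log ε) := by gcongr
    linarith [hC ε hε]
  have hlim : Tendsto (fun ε => m / K * (Real.log (K * d) - Real.log ε)) (𝓝[>] 0) atTop := by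
    refine Tendsto.const_mul_atTop (by positivity) ?_
    simp only [sub_eq_add_neg]
    exact tendsto_atTop_add_const_left _ _ (tendsto_neg_atBot_atTop.comp Real.tendsto_log_nhdsGT_zero)
  obtain ⟨ε, hε, hε'⟩ :=
    ((hlim.eventually_gt_atTop C).and (Ioc_mem_nhdsGT one_pos)).exists
  exact (key ε hε').not_gt hε

section Energy

variable {f : ℝ → ℝ} {u p q : ℝ → ℝ → ℝ} {a b τ : ℝ}

theorem IsClassicalSolutionOn.tendsto_integral_mul_slope (hu : IsClassicalSolutionOn f u p q a b τ)
    (hab : a ≤ b) {H : ℝ → ℝ → ℝ}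
    (hH : ContinuousOn (fun z : ℝ × ℝ => H z.1 z.2) (Icc a b ×ˢ Icc 0 τ))
    {s : ℝ} (hs : s ∈ Ico 0 τ) {r : ℝ → ℝ} (hr : Tendsto r (𝓝[>] s) (𝓝[Icc 0 τ] s)) :
    Tendsto (fun t => ∫ x in a..b, H x (r t) * ((t - s)⁻¹ * (u x t - u x s))) (𝓝[>] s)
      (𝓝 (∫ x in a..b, H x s * q x s)) := by
  have hsI : s ∈ Icc 0 τ := Ico_subset_Icc_self hs
  obtain ⟨C, hC0, hC⟩ := exists_bound_of_continuousOn_rect hH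
  obtain ⟨D, -, hD⟩ := exists_bound_of_continuousOn_rect hu.continuousOn_time
  have hmem : ∀ᶠ t in 𝓝[>] s, r t ∈ Icc 0 τ :=
    hr.eventually self_mem_nhdsWithin
  have hI : ∀ᶠ t in 𝓝[>] s, t ∈ Ioo s τ := Ioo_mem_nhdsGT hs.2
  refine tendsto_integral_filter_of_dominated_convergence (fun _ => C * D) ?_ ?_ (by simp) ?_
  · filter_upwards [hmem, hI] with t hrt ht
    have htI : t ∈ Icc 0 τ := ⟨hs.1.trans ht.1.le, ht.2.le⟩
    have hcu : ∀ t ∈ Icc 0 τ, ContinuousOn (fun x => u x t) (Icc a b) := fun t ht x hx =>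
      (hu.hasDerivAt_space x hx t ht).continuousAt.continuousWithinAt
    exact (((continuousOn_slice_left hH hrt).mul (continuousOn_const.mul
      ((hcu t htI).sub (hcu s hsI)))).intervalIntegrable_of_Icc
        hab).aestronglyMeasurable_restrict_uIoc
  · filter_upwards [hmem, hI] with t hrt ht
    refine .of_forall fun x hx => ?_
    rw [uIoc_of_le hab] at hx
    have hx := Ioc_subset_Icc_self hx
    have htI : t ∈ Icc 0 τ := ⟨hs.1.trans ht.1.le, ht.2.le⟩
    have h1 := (convex_Icc 0 τ).norm_image_sub_le_of_norm_hasDerivWithin_le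
      (hu.hasDerivWithinAt_time x hx) (hD x hx) hsI htI
    have hts : 0 < t - s := sub_pos.2 ht.1
    rw [norm_mul, norm_mul, norm_inv]
    refine mul_le_mul (hC x hx _ hrt) ?_ (by positivity) hC0
    rw [inv_mul_le_iff₀ (norm_pos_iff.2 hts.ne'), mul_comm]
    exact h1
  · refine .of_forall fun x hx => ?_
    rw [uIoc_of_le hab] at hx
    have hx := Ioc_subset_Icc_self hx
    refine Tendsto.mul ((continuousOn_slice_right hH hx s hsI).tendsto.comp hr) ?_
    have h1 : HasDerivWithinAt (fun t => u x t) (q x s) (Ioi s) s :=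
      (hu.hasDerivWithinAt_time x hx s hsI).mono_of_mem_nhdsWithin
        (mem_of_superset (Ioo_mem_nhdsGT hs.2) fun t ht => ⟨hs.1.trans ht.1.le, ht.2.le⟩)
    exact (hasDerivWithinAt_iff_tendsto_slope' self_notMem_Ioi).1 h1

/-- Convex functionals of `u_x` are differentiable in time along a `C¹` classical solution, although
`u_x` itself need not be. -/
theorem IsClassicalSolutionOn.tendsto_slope_integral (hu : IsClassicalSolutionOn f u p q a b τ)
    (hab : a ≤ b) {g η η' : ℝ → ℝ} {gx : ℝ → ℝ → ℝ} {R : ℝ} (hg : Monotone g) (hgc : Continuous g)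
    (hgx : ∀ x ∈ Icc a b, ∀ t ∈ Icc 0 τ, HasDerivAt (fun y => g (p y t)) (gx x t) x)
    (hgxc : ContinuousOn (fun z : ℝ × ℝ => gx z.1 z.2) (Icc a b ×ˢ Icc 0 τ))
    (hη : ∀ x, HasDerivAt η (η' x) x) (hη' : Continuous η') (hη0 : ∀ x, 0 ≤ η x)
    (hηa : η a = 0) (hηb : η b = 0) {s : ℝ} (hs : s ∈ Ico 0 τ) :
    Tendsto (slope (fun t => ∫ x in a..b, (∫ y in R..p x t, g y) * η x) s) (𝓝[>] s)
      (𝓝 (-∫ x in a..b, (gx x s * η x + g (p x s) * η' x) * q x s)) := by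
  have hsI : s ∈ Icc 0 τ := Ico_subset_Icc_self hs
  have hηc : Continuous η := continuous_iff_continuousAt.2 fun x => (hη x).continuousAt
  have hgp : ContinuousOn (fun z : ℝ × ℝ => g (p z.1 z.2)) (Icc a b ×ˢ Icc 0 τ) :=
    hgc.comp_continuousOn hu.continuousOn_space
  have hH : ContinuousOn (fun z : ℝ × ℝ => gx z.1 z.2 * η z.1 + g (p z.1 z.2) * η' z.1)
      (Icc a b ×ˢ Icc 0 τ) :=
    (hgxc.mul (hηc.comp continuous_fst).continuousOn).add
      (hgp.mul (hη'.comp continuous_fst).continuousOn)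
  have hprim : Continuous fun z => ∫ y in R..z, g y :=
    continuous_primitive (fun _ _ => hgc.intervalIntegrable _ _) R
  have hE : ContinuousOn (fun z : ℝ × ℝ => (∫ y in R..p z.1 z.2, g y) * η z.1)
      (Icc a b ×ˢ Icc 0 τ) :=
    (hprim.comp_continuousOn hu.continuousOn_space).mul (hηc.comp continuous_fst).continuousOn
  have hparts : ∀ r ∈ Icc 0 τ, ∀ t ∈ Icc 0 τ,
      (t - s)⁻¹ * ∫ x in a..b, g (p x r) * (p x t - p x s) * η x
      = -∫ x in a..b, (gx x r * η x + g (p x r) * η' x) * ((t - s)⁻¹ * (u x t - u x s)) := by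
    intro r hr t ht
    have := integral_mul_deriv_eq_deriv_mul (a := a) (b := b)
      (u := fun x => g (p x r) * η x) (u' := fun x => gx x r * η x + g (p x r) * η' x)
      (v := fun x => u x t - u x s) (v' := fun x => p x t - p x s)
      (fun x hx => by
        rw [uIcc_of_le hab] at hx
        exact (hgx x hx r hr).mul (hη x))
      (fun x hx => by
        rw [uIcc_of_le hab] at hx
        exact (hu.hasDerivAt_space x hx t ht).sub (hu.hasDerivAt_space x hx s hsI))
      (intervalIntegrable_slice (F := fun x t => gx x t * η x + g (p x t) * η' x) hab hH hr)
      ((intervalIntegrable_slice hab hu.continuousOn_space ht).sub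
        (intervalIntegrable_slice hab hu.continuousOn_space hsI))
    simp only [hηa, hηb, mul_zero, zero_mul, sub_zero, zero_sub] at this
    calc _ = (t - s)⁻¹ * ∫ x in a..b, g (p x r) * η x * (p x t - p x s) := by
          congr 2; ext x; ring
      _ = -((t - s)⁻¹ * ∫ x in a..b, (gx x r * η x + g (p x r) * η' x) * (u x t - u x s)) := by
          rw [this]; ring
      _ = _ := by
          rw [← intervalIntegral.integral_const_mul]
          congr 2; ext x; ring
  have hI : ∀ᶠ t in 𝓝[>] s, t ∈ Ioo s τ := Ioo_mem_nhdsGT hs.2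
  have hdiff : ∀ t ∈ Icc 0 τ, (∫ x in a..b, (∫ y in R..p x t, g y) * η x) -
      (∫ x in a..b, (∫ y in R..p x s, g y) * η x)
      = ∫ x in a..b, ((∫ y in R..p x t, g y) - ∫ y in R..p x s, g y) * η x := fun t ht => by
    rw [← intervalIntegral.integral_sub (intervalIntegrable_slice (F := fun x t => (∫ y in R..p x t, g y) * η x) hab hE ht)
      (intervalIntegrable_slice (F := fun x t => (∫ y in R..p x t, g y) * η x) hab hE hsI)]
    congr 1; ext x; ring
  have hint : ∀ r ∈ Icc 0 τ, ∀ t ∈ Icc 0 τ,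
      IntervalIntegrable (fun x => g (p x r) * (p x t - p x s) * η x) volume a b := fun r hr t ht =>
    (((continuousOn_slice_left (F := fun x t => g (p x t)) hgp hr).mul ((continuousOn_slice_left hu.continuousOn_space ht).sub
      (continuousOn_slice_left hu.continuousOn_space hsI))).mul
        hηc.continuousOn).intervalIntegrable_of_Icc hab
  have hint' : ∀ t ∈ Icc 0 τ, IntervalIntegrable
      (fun x => ((∫ y in R..p x t, g y) - ∫ y in R..p x s, g y) * η x) volume a b := fun t ht => by
    refine ((intervalIntegrable_slice (F := fun x t => (∫ y in R..p x t, g y) * η x) hab hE ht).sub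
      (intervalIntegrable_slice (F := fun x t => (∫ y in R..p x t, g y) * η x) hab hE hsI)).congr ?_
    exact fun x _ => (sub_mul _ _ _).symm
  refine tendsto_of_tendsto_of_tendsto_of_le_of_le'
    (hu.tendsto_integral_mul_slope (H := fun x t => gx x t * η x + g (p x t) * η' x) hab hH hs (r := fun _ => s)
      (tendsto_const_pure.mono_right (pure_le_nhdsWithin hsI))).neg
    (hu.tendsto_integral_mul_slope (H := fun x t => gx x t * η x + g (p x t) * η' x) hab hH hs (r := fun t => t) ?_).neg ?_ ?_
  · refine tendsto_id.mono_right (nhdsWithin_le_iff.2 ?_) |>.mono_left le_rfl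
    exact mem_of_superset (Ioo_mem_nhdsGT hs.2) fun t ht => ⟨hs.1.trans ht.1.le, ht.2.le⟩
  · filter_upwards [hI] with t ht
    have htI : t ∈ Icc 0 τ := ⟨hs.1.trans ht.1.le, ht.2.le⟩
    have hts : 0 < t - s := sub_pos.2 ht.1
    rw [← hparts s hsI t htI, slope_def_field, div_eq_inv_mul, hdiff t htI]
    gcongr
    refine integral_mono_on hab (hint s hsI t htI) (hint' t htI) fun x _ => ?_
    exact mul_le_mul_of_nonneg_right (hg.le_integral_sub _ _ _) (hη0 x)
  · filter_upwards [hI] with t ht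
    have htI : t ∈ Icc 0 τ := ⟨hs.1.trans ht.1.le, ht.2.le⟩
    have hts : 0 < t - s := sub_pos.2 ht.1
    rw [← hparts t htI t htI, slope_def_field, div_eq_inv_mul, hdiff t htI]
    gcongr
    refine integral_mono_on hab (hint' t htI) (hint t htI t htI) fun x _ => ?_
    exact mul_le_mul_of_nonneg_right (hg.integral_sub_le _ _ _) (hη0 x)

end Energy

namespace IsPeronaMalikFlux

variable {f : ℝ → ℝ} {ε : ℝ}

theorem continuous (hf : IsPeronaMalikFlux f) : Continuous f := hf.differentiable.continuous

theorem apply_neg_one (hf : IsPeronaMalikFlux f) : f (-1) = -f 1 := hf.odd 1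

theorem apply_one_pos (hf : IsPeronaMalikFlux f) : 0 < f 1 := by
  have h0 : f 0 = 0 := by
    have := hf.odd 0
    rw [neg_zero] at this
    linarith
  rw [← h0]
  exact hf.strictMonoOn (by simp) (by simp) one_pos

theorem apply_le_apply_one (hf : IsPeronaMalikFlux f) {σ : ℝ} (hσ : -1 ≤ σ) : f σ ≤ f 1 := by
  rcases le_total σ 1 with h | h
  · exact hf.strictMonoOn.monotoneOn ⟨hσ, h⟩ (by simp) h
  · exact hf.antitoneOn_Ici self_mem_Ici h h

theorem apply_neg_one_le (hf : IsPeronaMalikFlux f) {σ : ℝ} (hσ : σ ≤ 1) : f (-1) ≤ f σ := by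
  have := hf.apply_le_apply_one (neg_le_neg hσ)
  rw [hf.odd] at this
  linarith [hf.apply_neg_one]

theorem isLocalExtr_one (hf : IsPeronaMalikFlux f) : IsLocalExtr f 1 := by
  refine .inr ?_
  filter_upwards [Ici_mem_nhds (show (-1 : ℝ) < 1 by norm_num)] with σ hσ
  exact hf.apply_le_apply_one hσ

theorem isLocalExtr_neg_one (hf : IsPeronaMalikFlux f) : IsLocalExtr f (-1) := by
  refine .inl ?_
  filter_upwards [Iic_mem_nhds (show (-1 : ℝ) < 1 by norm_num)] with σ hσ
  exact hf.apply_neg_one_le hσ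

/-- The gap between the maximum of the flux and the flux, the latter truncated from below. -/
theorem gap_nonneg (hf : IsPeronaMalikFlux f) (σ : ℝ) : 0 ≤ f 1 - f (max σ (-1)) :=
  sub_nonneg.2 (hf.apply_le_apply_one (le_max_right _ _))

theorem continuous_max (hf : IsPeronaMalikFlux f) (c : ℝ) : Continuous fun σ => f (max σ c) :=
  hf.continuous.comp (continuous_id.max continuous_const)

theorem antitone_comp_max_one (hf : IsPeronaMalikFlux f) : Antitone fun σ => f (max σ 1) :=
  fun _ _ h => hf.antitoneOn_Ici (mem_Ici.2 (le_max_right _ _)) (mem_Ici.2 (le_max_right _ _)) (max_le_max_right _ h)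

theorem comp_max_one_sub_comp_max_neg_one (f : ℝ → ℝ) (σ : ℝ) :
    f (max σ 1) - f (max σ (-1)) = f 1 - f (max (min σ 1) (-1)) := by
  rcases le_total σ 1 with h | h
  · simp [h]
  · have : (-1 : ℝ) ≤ σ := by linarith
    simp [h, this]

theorem antitone_truncated_gap (hf : IsPeronaMalikFlux f) :
    Antitone fun σ => f (max σ 1) - f (max σ (-1)) := by
  intro σ ρ h
  simp only [comp_max_one_sub_comp_max_neg_one]
  have hmem : ∀ σ : ℝ, max (min σ 1) (-1) ∈ Icc (-1 : ℝ) 1 := fun σ =>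
    ⟨le_max_right _ _, max_le (min_le_right _ _) (by norm_num)⟩
  have := hf.strictMonoOn.monotoneOn (hmem σ) (hmem ρ)
    (max_le_max_right _ (min_le_min_right _ h))
  linarith

theorem truncated_gap_nonneg (hf : IsPeronaMalikFlux f) (σ : ℝ) :
    0 ≤ f (max σ 1) - f (max σ (-1)) := by
  rw [comp_max_one_sub_comp_max_neg_one]
  exact hf.gap_nonneg _

theorem monotone_inv_sq_truncated_gap (hf : IsPeronaMalikFlux f) (hε : 0 < ε) :
    Monotone fun σ => ((f (max σ 1) - f (max σ (-1)) + ε) ^ 2)⁻¹ := by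
  intro σ ρ h
  have h1 := hf.antitone_truncated_gap h
  have h2 := hf.truncated_gap_nonneg ρ
  have h3 : 0 < f (max ρ 1) - f (max ρ (-1)) + ε := by linarith
  simp only at h1 ⊢
  gcongr

theorem monotone_neg_inv_sq_supercritical_gap (hf : IsPeronaMalikFlux f) (hε : 0 < ε) :
    Monotone fun σ => (ε ^ 2)⁻¹ - ((f 1 - f (max σ 1) + ε) ^ 2)⁻¹ := by
  intro σ ρ h
  have h1 := hf.antitone_comp_max_one h
  have h2 : f (max σ 1) ≤ f 1 :=
    hf.apply_le_apply_one ((by norm_num : (-1 : ℝ) ≤ 1).trans (le_max_right _ _))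
  have h3 : 0 < f 1 - f (max σ 1) + ε := by linarith
  simp only at h1 ⊢
  gcongr

theorem inv_sq_gap_decomposition (f : ℝ → ℝ) (ε σ : ℝ) :
    ((f (max σ 1) - f (max σ (-1)) + ε) ^ 2)⁻¹ - ((ε ^ 2)⁻¹ - ((f 1 - f (max σ 1) + ε) ^ 2)⁻¹)
      = ((f 1 - f (max σ (-1)) + ε) ^ 2)⁻¹ := by
  rcases le_total σ 1 with h | h
  · simp [h]
  · have : (-1 : ℝ) ≤ σ := by linarith
    simp [h, this]

theorem continuous_inv_sq_gap (hf : IsPeronaMalikFlux f) (hε : 0 < ε) :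
    Continuous fun σ => ((f 1 - f (max σ (-1)) + ε) ^ 2)⁻¹ := by
  refine (((continuous_const.sub (hf.continuous_max _)).add continuous_const).pow 2).inv₀
    fun σ => ?_
  exact (pow_pos (add_pos_of_nonneg_of_pos (hf.gap_nonneg σ) hε) 2).ne'

theorem integral_inv_sq_gap_nonneg (f : ℝ → ℝ) {ε σ ρ : ℝ} (h : σ ≤ ρ) :
    0 ≤ ∫ y in σ..ρ, ((f 1 - f (max y (-1)) + ε) ^ 2)⁻¹ :=
  integral_nonneg h fun _ _ => by positivity

theorem inv_gap_le (hf : IsPeronaMalikFlux f) (hε : 0 < ε) {L R σ : ℝ}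
    (hL : ∀ y ∈ Icc (-1 : ℝ) 1, |deriv f y| ≤ L) (hR : 1 ≤ R) (hσ : -R ≤ σ) :
    (f 1 - f (max σ (-1)) + ε)⁻¹
      ≤ L * (∫ y in -R..σ, ((f 1 - f (max y (-1)) + ε) ^ 2)⁻¹) + (f 1)⁻¹ := by
  have hM := hf.apply_one_pos
  have hL0 : 0 ≤ L := (abs_nonneg _).trans (hL 0 (by simp))
  have hG := hf.continuous_inv_sq_gap hε
  have hGi : ∀ c d, IntervalIntegrable (fun y => ((f 1 - f (max y (-1)) + ε) ^ 2)⁻¹) volume c d :=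
    fun _ _ => hG.intervalIntegrable _ _
  have hneg : (f 1 - f (-1) + ε)⁻¹ ≤ (f 1)⁻¹ := by
    rw [hf.apply_neg_one]
    gcongr
    linarith
  rcases le_total σ (-1) with h1 | h1
  · rw [max_eq_right h1]
    have := mul_nonneg hL0 (integral_inv_sq_gap_nonneg f (ε := ε) hσ)
    linarith
  have hsub : ∀ ρ ∈ Icc (-1 : ℝ) 1, (f 1 - f ρ + ε)⁻¹
      ≤ L * (∫ y in -R..ρ, ((f 1 - f (max y (-1)) + ε) ^ 2)⁻¹) + (f 1)⁻¹ := by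
    intro ρ hρ
    have hpos : ∀ y ∈ Icc (-1) ρ, 0 < f 1 - f y + ε := fun y hy => by
      have := hf.apply_le_apply_one hy.1
      linarith
    have hder : ∀ y ∈ Icc (-1) ρ, HasDerivAt (fun y => (f 1 - f y + ε)⁻¹)
        (deriv f y * ((f 1 - f y + ε) ^ 2)⁻¹) y := fun y hy => by
      refine ((((hf.differentiable y).hasDerivAt.const_sub (f 1)).add_const ε).inv
        (hpos y hy).ne').congr_deriv ?_
      rw [neg_neg, div_eq_mul_inv]
    have hci : IntervalIntegrable (fun y => deriv f y * ((f 1 - f y + ε) ^ 2)⁻¹)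
        volume (-1) ρ :=
      (hf.continuous_deriv.continuousOn.mul (ContinuousOn.inv₀ (by have := hf.continuous; fun_prop)
        fun y hy => (pow_pos (hpos y hy) 2).ne')).intervalIntegrable_of_Icc hρ.1
    have hftc := integral_eq_sub_of_hasDerivAt (fun y hy => hder y (by rwa [uIcc_of_le hρ.1] at hy)) hci
    have hle : ∫ y in -1..ρ, deriv f y * ((f 1 - f y + ε) ^ 2)⁻¹
        ≤ ∫ y in -1..ρ, L * ((f 1 - f (max y (-1)) + ε) ^ 2)⁻¹ := by
      refine integral_mono_on hρ.1 hci ((hGi _ _).const_mul L) fun y hy => ?_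
      rw [max_eq_left hy.1]
      have := (le_abs_self _).trans (hL y ⟨hy.1, hy.2.trans hρ.2⟩)
      gcongr
    rw [intervalIntegral.integral_const_mul] at hle
    have hadd := integral_add_adjacent_intervals (hGi (-R) (-1)) (hGi (-1) ρ)
    have hnn := integral_inv_sq_gap_nonneg f (ε := ε) (neg_le_neg hR)
    rw [← hadd, mul_add]
    have := mul_nonneg hL0 hnn
    linarith
  rcases le_total σ 1 with h2 | h2
  · rw [max_eq_left h1]
    exact hsub σ ⟨h1, h2⟩
  · have hadd := integral_add_adjacent_intervals (hGi (-R) 1) (hGi 1 σ)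
    have hnn := mul_nonneg hL0 (integral_inv_sq_gap_nonneg f (ε := ε) h2)
    have h3 := hsub 1 (by simp)
    have h4 : (f 1 - f (max σ (-1)) + ε)⁻¹ ≤ (f 1 - f 1 + ε)⁻¹ := by
      have := hf.gap_nonneg σ
      gcongr <;> linarith
    rw [← hadd, mul_add]
    linarith

theorem integral_inv_sq_gap_le (hf : IsPeronaMalikFlux f) (hε : 0 < ε) {R σ ρ : ℝ} (hσ : -R ≤ σ)
    (hσρ : σ ≤ ρ) (hρ0 : 0 ≤ ρ) (hρ1 : ρ < 1) :
    ∫ y in -R..σ, ((f 1 - f (max y (-1)) + ε) ^ 2)⁻¹ ≤ (ρ + R) * ((f 1 - f ρ) ^ 2)⁻¹ := by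
  have hpos : 0 < f 1 - f ρ := sub_pos.2 (hf.strictMonoOn ⟨by linarith, hρ1.le⟩ (by simp) hρ1)
  calc _ ≤ ∫ _ in -R..σ, ((f 1 - f ρ) ^ 2)⁻¹ := by
        refine integral_mono_on hσ ((hf.continuous_inv_sq_gap hε).intervalIntegrable _ _)
          intervalIntegrable_const fun y hy => ?_
        have h1 : max y (-1) ≤ ρ := max_le (hy.2.trans hσρ) (by linarith)
        have := hf.strictMonoOn.monotoneOn ⟨le_max_right y (-1), h1.trans hρ1.le⟩
          ⟨by linarith, hρ1.le⟩ h1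
        gcongr
        linarith
    _ = (σ + R) * ((f 1 - f ρ) ^ 2)⁻¹ := by simp
    _ ≤ _ := by gcongr

end IsPeronaMalikFlux

namespace IsClassicalSolutionOn

variable {f : ℝ → ℝ} {u p q : ℝ → ℝ → ℝ} {a b τ ε : ℝ}

theorem hasDerivAt_comp_max (hu : IsClassicalSolutionOn f u p q a b τ) {c : ℝ}
    (hc : IsLocalExtr f c) {x t : ℝ} (hx : x ∈ Icc a b) (ht : t ∈ Icc 0 τ) :
    HasDerivAt (fun y => f (max (p y t) c)) (if c < p x t then q x t else 0) x :=
  _root_.hasDerivAt_comp_max hc (hu.continuousAt_space x hx t ht) (hu.hasDerivAt_flux x hx t ht)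

theorem continuousOn_ite (hu : IsClassicalSolutionOn f u p q a b τ) {c : ℝ}
    (hc : IsLocalExtr f c) :
    ContinuousOn (fun z : ℝ × ℝ => if c < p z.1 z.2 then q z.1 z.2 else 0)
      (Icc a b ×ˢ Icc 0 τ) := by
  refine continuousOn_ite_lt hu.continuousOn_space hu.continuousOn_time fun z hz h => ?_
  subst h
  refine IsLocalExtr.hasDerivAt_eq_zero (f := fun y => f (p y z.2)) ?_
    (hu.hasDerivAt_flux z.1 hz.1 z.2 hz.2)
  exact IsExtrFilter.comp_tendsto (g := fun y => p y z.2) hc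
    (hu.continuousAt_space z.1 hz.1 z.2 hz.2)

theorem continuousOn_comp (hu : IsClassicalSolutionOn f u p q a b τ) {g : ℝ → ℝ}
    (hg : Continuous g) :
    ContinuousOn (fun z : ℝ × ℝ => g (p z.1 z.2)) (Icc a b ×ˢ Icc 0 τ) :=
  hg.comp_continuousOn hu.continuousOn_space

/-- The dissipation formula for the energy with density `∫ (gap + ε)⁻²`. -/
theorem tendsto_slope_energy (hu : IsClassicalSolutionOn f u p q a b τ)
    (hf : IsPeronaMalikFlux f) (hab : a ≤ b) (hε : 0 < ε) {η η' : ℝ → ℝ} {R : ℝ}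
    (hη : ∀ x, HasDerivAt η (η' x) x) (hη' : Continuous η') (hη0 : ∀ x, 0 ≤ η x)
    (hηa : η a = 0) (hηb : η b = 0) {s : ℝ} (hs : s ∈ Ico 0 τ) :
    Tendsto (slope (fun t => ∫ x in a..b,
        (∫ y in R..p x t, ((f 1 - f (max y (-1)) + ε) ^ 2)⁻¹) * η x) s) (𝓝[>] s)
      (𝓝 (-∫ x in a..b, (2 * (if -1 < p x s then q x s else 0)
          / (f 1 - f (max (p x s) (-1)) + ε) ^ 3 * η x
        + ((f 1 - f (max (p x s) (-1)) + ε) ^ 2)⁻¹ * η' x) * q x s)) := by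
  have hsI : s ∈ Icc 0 τ := Ico_subset_Icc_self hs
  have hηc : Continuous η := continuous_iff_continuousAt.2 fun x => (hη x).continuousAt
  have hfc := hf.continuous
  have hpos₁ : ∀ σ, 0 < f (max σ 1) - f (max σ (-1)) + ε := fun σ =>
    add_pos_of_nonneg_of_pos (hf.truncated_gap_nonneg σ) hε
  have hpos₂ : ∀ σ, 0 < f 1 - f (max σ 1) + ε := fun σ => by
    have := hf.apply_le_apply_one ((by norm_num : (-1 : ℝ) ≤ 1).trans (le_max_right σ 1))
    linarith
  have hg₁ : Continuous fun σ => ((f (max σ 1) - f (max σ (-1)) + ε) ^ 2)⁻¹ :=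
    Continuous.inv₀ (by fun_prop) fun σ => (pow_pos (hpos₁ σ) 2).ne'
  have hg₂ : Continuous fun σ => (ε ^ 2)⁻¹ - ((f 1 - f (max σ 1) + ε) ^ 2)⁻¹ :=
    continuous_const.sub (Continuous.inv₀ (by fun_prop) fun σ => (pow_pos (hpos₂ σ) 2).ne')
  have hqA := hu.continuousOn_ite hf.isLocalExtr_neg_one
  have hqB := hu.continuousOn_ite hf.isLocalExtr_one
  have hd₁ : ContinuousOn (fun z : ℝ × ℝ => 2 * ((if -1 < p z.1 z.2 then q z.1 z.2 else 0)
      - if 1 < p z.1 z.2 then q z.1 z.2 else 0)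
      / (f (max (p z.1 z.2) 1) - f (max (p z.1 z.2) (-1)) + ε) ^ 3) (Icc a b ×ˢ Icc 0 τ) :=
    (continuousOn_const.mul (hqA.sub hqB)).div
      (hu.continuousOn_comp (g := fun σ => (f (max σ 1) - f (max σ (-1)) + ε) ^ 3) (by fun_prop))
      fun z _ => (pow_pos (hpos₁ _) 3).ne'
  have hd₂ : ContinuousOn (fun z : ℝ × ℝ => -(2 * (if 1 < p z.1 z.2 then q z.1 z.2 else 0))
      / (f 1 - f (max (p z.1 z.2) 1) + ε) ^ 3) (Icc a b ×ˢ Icc 0 τ) :=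
    (continuousOn_const.mul hqB).neg.div
      (hu.continuousOn_comp (g := fun σ => (f 1 - f (max σ 1) + ε) ^ 3) (by fun_prop))
      fun z _ => (pow_pos (hpos₂ _) 3).ne'
  have h₁ := hu.tendsto_slope_integral hab (R := R)
    (g := fun σ => ((f (max σ 1) - f (max σ (-1)) + ε) ^ 2)⁻¹)
    (gx := fun x t => 2 * ((if -1 < p x t then q x t else 0) - if 1 < p x t then q x t else 0)
      / (f (max (p x t) 1) - f (max (p x t) (-1)) + ε) ^ 3)
    (hf.monotone_inv_sq_truncated_gap hε) hg₁ (fun x hx t ht => by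
      have hne := (hpos₁ (p x t)).ne'
      refine ((((hu.hasDerivAt_comp_max hf.isLocalExtr_one hx ht).sub
        (hu.hasDerivAt_comp_max hf.isLocalExtr_neg_one hx ht)).add_const ε).pow 2 |>.inv
        (pow_ne_zero 2 hne)).congr_deriv ?_
      simp only [Pi.sub_apply, Pi.pow_apply]
      field_simp
      ring) hd₁ hη hη' hη0 hηa hηb hs
  have h₂ := hu.tendsto_slope_integral hab (R := R)
    (g := fun σ => (ε ^ 2)⁻¹ - ((f 1 - f (max σ 1) + ε) ^ 2)⁻¹)
    (gx := fun x t => -(2 * (if 1 < p x t then q x t else 0)) / (f 1 - f (max (p x t) 1) + ε) ^ 3)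
    (hf.monotone_neg_inv_sq_supercritical_gap hε) hg₂ (fun x hx t ht => by
      have hne := (hpos₂ (p x t)).ne'
      refine (((((hu.hasDerivAt_comp_max hf.isLocalExtr_one hx ht).const_sub (f 1)).add_const
        ε).pow 2 |>.inv (pow_ne_zero 2 hne)).const_sub _).congr_deriv ?_
      simp only [Pi.pow_apply]
      field_simp
      ring) hd₂ hη hη' hη0 hηa hηb hs
  have hprim : ∀ {g : ℝ → ℝ}, Continuous g → ContinuousOn
      (fun z : ℝ × ℝ => (∫ y in R..p z.1 z.2, g y) * η z.1) (Icc a b ×ˢ Icc 0 τ) := fun hg =>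
    (hu.continuousOn_comp (continuous_primitive (fun _ _ => hg.intervalIntegrable _ _) R)).mul
      (hηc.comp continuous_fst).continuousOn
  have hE : ∀ t ∈ Icc 0 τ,
      (∫ x in a..b, (∫ y in R..p x t, ((f 1 - f (max y (-1)) + ε) ^ 2)⁻¹) * η x)
      = (∫ x in a..b, (∫ y in R..p x t, ((f (max y 1) - f (max y (-1)) + ε) ^ 2)⁻¹) * η x)
      - ∫ x in a..b, (∫ y in R..p x t, ((ε ^ 2)⁻¹ - ((f 1 - f (max y 1) + ε) ^ 2)⁻¹)) * η x := by
    intro t ht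
    rw [← intervalIntegral.integral_sub
      (intervalIntegrable_slice
        (F := fun x t => (∫ y in R..p x t, ((f (max y 1) - f (max y (-1)) + ε) ^ 2)⁻¹) * η x)
        hab (hprim hg₁) ht)
      (intervalIntegrable_slice
        (F := fun x t => (∫ y in R..p x t, ((ε ^ 2)⁻¹ - ((f 1 - f (max y 1) + ε) ^ 2)⁻¹)) * η x)
        hab (hprim hg₂) ht)]
    congr 1
    ext x
    rw [← sub_mul, ← intervalIntegral.integral_sub (hg₁.intervalIntegrable _ _)
      (hg₂.intervalIntegrable _ _)]
    simp only [IsPeronaMalikFlux.inv_sq_gap_decomposition]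
  have hI : ∀ (g : ℝ → ℝ) (gx : ℝ → ℝ → ℝ), Continuous g →
      ContinuousOn (fun z : ℝ × ℝ => gx z.1 z.2) (Icc a b ×ˢ Icc 0 τ) →
      IntervalIntegrable (fun x => (gx x s * η x + g (p x s) * η' x) * q x s) volume a b := by
    intro g gx hg hgx
    refine intervalIntegrable_slice (F := fun x s => (gx x s * η x + g (p x s) * η' x) * q x s) hab
      ?_ hsI
    exact ((hgx.mul (hηc.comp continuous_fst).continuousOn).add ((hu.continuousOn_comp hg).mul
      (hη'.comp continuous_fst).continuousOn)).mul hu.continuousOn_time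
  have hlim := h₁.sub h₂
  rw [neg_sub_neg, ← neg_sub, ← intervalIntegral.integral_sub
    (hI (fun σ => ((f (max σ 1) - f (max σ (-1)) + ε) ^ 2)⁻¹)
      (fun x t => 2 * ((if -1 < p x t then q x t else 0) - if 1 < p x t then q x t else 0)
        / (f (max (p x t) 1) - f (max (p x t) (-1)) + ε) ^ 3) hg₁ hd₁)
    (hI (fun σ => (ε ^ 2)⁻¹ - ((f 1 - f (max σ 1) + ε) ^ 2)⁻¹)
      (fun x t => -(2 * (if 1 < p x t then q x t else 0))
        / (f 1 - f (max (p x t) 1) + ε) ^ 3) hg₂ hd₂)] at hlim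
  refine Tendsto.congr' ?_ (hlim.trans_eq ?_)
  · filter_upwards [Ioo_mem_nhdsGT hs.2] with t ht
    rw [slope_def_field, slope_def_field, slope_def_field, hE s hsI,
      hE t ⟨hs.1.trans ht.1.le, ht.2.le⟩]
    ring
  · congr 2
    refine integral_congr fun x _ => ?_
    rw [← IsPeronaMalikFlux.inv_sq_gap_decomposition]
    rcases le_or_gt (p x s) 1 with h | h
    · rw [max_eq_right h, if_neg h.not_gt]
      ring
    · have h' : -1 < p x s := by linarith
      rw [max_eq_left h.le, max_eq_left h'.le, if_pos h, if_pos h']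
      ring

/-- The integrand of the dissipation formula with weight `z⁴`, where `z'' = -κ² z`, is controlled up
to the exact derivative of `2 z³ z' / (gap + ε)`. -/
theorem _root_.dissipation_le {y z z' v κ : ℝ} (hy : 0 < y) :
    -((2 * v / y ^ 3 * z ^ 4 + (y ^ 2)⁻¹ * (4 * z ^ 3 * z')) * v)
      ≤ 2 * κ ^ 2 * (z ^ 4 / y) + 2 * (v / y ^ 2 * (z ^ 3 * z')
        + y⁻¹ * (3 * z ^ 2 * z' ^ 2 - κ ^ 2 * z ^ 4)) := by
  have h : 0 ≤ z ^ 2 / y * (2 * (z * v / y + 3 / 2 * z') ^ 2 + 3 / 2 * z' ^ 2) := by positivity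
  have h' : z ^ 2 / y * (2 * (z * v / y + 3 / 2 * z') ^ 2 + 3 / 2 * z' ^ 2)
      = 2 * κ ^ 2 * (z ^ 4 / y) + 2 * (v / y ^ 2 * (z ^ 3 * z')
        + y⁻¹ * (3 * z ^ 2 * z' ^ 2 - κ ^ 2 * z ^ 4))
        + (2 * v / y ^ 3 * z ^ 4 + (y ^ 2)⁻¹ * (4 * z ^ 3 * z')) * v := by
    field_simp
    ring
  linarith

theorem exists_energy_deriv_le (hu : IsClassicalSolutionOn f u p q a b τ)
    (hf : IsPeronaMalikFlux f) (hab : a ≤ b) {κ : ℝ} (hκ : 0 ≤ κ)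
    (hκb : Real.sin (κ * (b - a)) = 0) :
    ∃ C, ∀ ε, 0 < ε → ∀ s ∈ Icc 0 τ,
      (-∫ x in a..b, (2 * (if -1 < p x s then q x s else 0)
          / (f 1 - f (max (p x s) (-1)) + ε) ^ 3 * Real.sin (κ * (x - a)) ^ 4
        + ((f 1 - f (max (p x s) (-1)) + ε) ^ 2)⁻¹
          * (4 * Real.sin (κ * (x - a)) ^ 3 * (κ * Real.cos (κ * (x - a))))) * q x s)
      ≤ 2 * κ ^ 2 * (∫ x in a..b, Real.sin (κ * (x - a)) ^ 4
          / (f 1 - f (max (p x s) (-1)) + ε)) + C := by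
  obtain ⟨D, hD0, hD⟩ := exists_bound_of_continuousOn_rect hu.continuousOn_time
  have hM := hf.apply_one_pos
  have hfc := hf.continuous
  refine ⟨4 * κ * D / f 1 ^ 2 * (b - a), fun ε hε s hs => ?_⟩
  set z : ℝ → ℝ := fun x => Real.sin (κ * (x - a)) with hz
  set z' : ℝ → ℝ := fun x => κ * Real.cos (κ * (x - a)) with hz'
  set y : ℝ → ℝ := fun x => f 1 - f (max (p x s) (-1)) + ε with hy
  set v : ℝ → ℝ := fun x => if -1 < p x s then q x s else 0 with hv
  have hypos : ∀ x, 0 < y x := fun x => add_pos_of_nonneg_of_pos (hf.gap_nonneg _) hε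
  have hzc : Continuous z := by fun_prop
  have hzc' : Continuous z' := by fun_prop
  have hyc : ContinuousOn y (Icc a b) := continuousOn_slice_left
    (F := fun x s => f 1 - f (max (p x s) (-1)) + ε)
    (hu.continuousOn_comp (g := fun σ => f 1 - f (max σ (-1)) + ε) (by fun_prop)) hs
  have hvc : ContinuousOn v (Icc a b) := continuousOn_slice_left
    (F := fun x s => if -1 < p x s then q x s else 0) (hu.continuousOn_ite hf.isLocalExtr_neg_one) hs
  have hqc : ContinuousOn (fun x => q x s) (Icc a b) :=
    continuousOn_slice_left hu.continuousOn_time hs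
  have hyne : ∀ n : ℕ, ∀ x ∈ Icc a b, y x ^ n ≠ 0 := fun n x _ => (pow_pos (hypos x) n).ne'
  have hdz : ∀ x, HasDerivAt z (z' x) x := fun x => by
    simpa [hz, hz', mul_comm] using (((hasDerivAt_id x).sub_const a).const_mul κ).sin
  have hdz' : ∀ x, HasDerivAt z' (-κ ^ 2 * z x) x := fun x => by
    refine ((((hasDerivAt_id x).sub_const a).const_mul κ).cos.const_mul κ).congr_deriv ?_
    simp only [hz, id]
    ring
  have hdy : ∀ x ∈ Icc a b, HasDerivAt y (-v x) x := fun x hx =>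
    ((hu.hasDerivAt_comp_max hf.isLocalExtr_neg_one hx hs).const_sub (f 1)).add_const ε
  have hI₁ : IntervalIntegrable
      (fun x => (2 * v x / y x ^ 3 * z x ^ 4 + (y x ^ 2)⁻¹ * (4 * z x ^ 3 * z' x)) * q x s)
      volume a b := by
    refine ContinuousOn.intervalIntegrable_of_Icc hab (.mul (.add (.mul (.div ?_ (hyc.pow 3)
      (hyne 3)) ?_) (.mul ((hyc.pow 2).inv₀ (hyne 2)) ?_)) hqc) <;> fun_prop
  have hI₂ : IntervalIntegrable (fun x => v x / y x ^ 2 * (z x ^ 3 * z' x)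
        + (y x)⁻¹ * (3 * z x ^ 2 * z' x ^ 2 - κ ^ 2 * z x ^ 4)) volume a b := by
    refine ContinuousOn.intervalIntegrable_of_Icc hab (.add (.mul (hvc.div (hyc.pow 2)
      (hyne 2)) ?_) (.mul (hyc.inv₀ fun x _ => (hypos x).ne') ?_)) <;> fun_prop
  have hI₃ : IntervalIntegrable (fun x => z x ^ 4 / y x) volume a b :=
    ((hzc.pow 4).continuousOn.div hyc fun x _ => (hypos x).ne').intervalIntegrable_of_Icc hab
  have hexact : ∫ x in a..b, (v x / y x ^ 2 * (z x ^ 3 * z' x)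
        + (y x)⁻¹ * (3 * z x ^ 2 * z' x ^ 2 - κ ^ 2 * z x ^ 4)) = 0 := by
    rw [integral_eq_sub_of_hasDerivAt (f := fun x => (y x)⁻¹ * (z x ^ 3 * z' x)) _ hI₂]
    · have h1 : z b = 0 := hκb
      have h2 : z a = 0 := by simp [hz]
      simp [h1, h2]
    · intro x hx
      rw [uIcc_of_le hab] at hx
      refine (((hdy x hx).inv (hypos x).ne').mul (((hdz x).pow 3).mul (hdz' x))).congr_deriv ?_
      simp only [Pi.inv_apply, Pi.mul_apply, Pi.pow_apply]
      push_cast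
      ring
  have hpt : ∀ x ∈ Icc a b,
      -((2 * v x / y x ^ 3 * z x ^ 4 + (y x ^ 2)⁻¹ * (4 * z x ^ 3 * z' x)) * q x s)
      ≤ 2 * κ ^ 2 * (z x ^ 4 / y x) + 2 * (v x / y x ^ 2 * (z x ^ 3 * z' x)
        + (y x)⁻¹ * (3 * z x ^ 2 * z' x ^ 2 - κ ^ 2 * z x ^ 4)) + 4 * κ * D / f 1 ^ 2 := by
    intro x hx
    have hC : 0 ≤ 4 * κ * D / f 1 ^ 2 := by positivity
    have hyx := hypos x
    by_cases h : -1 < p x s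
    · have hvq : v x = q x s := if_pos h
      rw [← hvq]
      linarith [dissipation_le (z := z x) (z' := z' x) (v := v x) (κ := κ) hyx]
    · have hv0 : v x = 0 := if_neg h
      have hyM : f 1 ≤ y x := by
        simp only [hy]
        rw [max_eq_right (not_lt.1 h), hf.apply_neg_one]
        linarith
      have h1 := dissipation_le (z := z x) (z' := z' x) (v := 0) (κ := κ) hyx
      have h2 : -((y x ^ 2)⁻¹ * (4 * z x ^ 3 * z' x) * q x s) ≤ 4 * κ * D / f 1 ^ 2 := by
        have hzx : |z x| ≤ 1 := Real.abs_sin_le_one _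
        have hzx' : |z' x| ≤ κ := by
          simp only [hz']
          rw [abs_mul, abs_of_nonneg hκ]
          exact mul_le_of_le_one_right hκ (Real.abs_cos_le_one _)
        have hqx := hD x hx s hs
        refine (neg_le_abs _).trans ?_
        rw [abs_mul, abs_mul, abs_mul, abs_mul, abs_inv, abs_pow, abs_pow, abs_of_pos hyx]
        calc _ ≤ (f 1 ^ 2)⁻¹ * (|4| * 1 ^ 3 * κ) * D := by gcongr
          _ = _ := by rw [abs_of_pos (by norm_num : (0 : ℝ) < 4)]; ring
      rw [hv0]
      simp only [mul_zero, zero_div, zero_mul, zero_add, neg_zero] at h1 ⊢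
      linarith
  have hfin := integral_mono_on hab hI₁.neg
    (((hI₃.const_mul (2 * κ ^ 2)).add (hI₂.const_mul 2)).add intervalIntegrable_const) hpt
  simp only [Pi.neg_apply] at hfin
  rw [intervalIntegral.integral_neg, intervalIntegral.integral_add
      ((hI₃.const_mul (2 * κ ^ 2)).add (hI₂.const_mul 2)) intervalIntegrable_const,
    intervalIntegral.integral_add (hI₃.const_mul (2 * κ ^ 2)) (hI₂.const_mul 2),
    intervalIntegral.integral_const_mul, intervalIntegral.integral_const_mul, hexact,
    intervalIntegral.integral_const, smul_eq_mul] at hfin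
  linarith


/-- Along a solution with initial slope below one, the inverse gap stays locally integrable. -/
theorem exists_integral_div_gap_le (hu : IsClassicalSolutionOn f u p q a b τ)
    (hf : IsPeronaMalikFlux f) (hab : a ≤ b) (hτ : 0 ≤ τ) (h0 : ∀ x ∈ Icc a b, p x 0 < 1)
    {κ : ℝ} (hκ : 0 ≤ κ) (hκb : Real.sin (κ * (b - a)) = 0) :
    ∃ C, ∀ ε, 0 < ε → ∫ x in a..b, Real.sin (κ * (x - a)) ^ 4
      / (f 1 - f (max (p x τ) (-1)) + ε) ≤ C := by
  obtain ⟨B, -, hB⟩ := exists_bound_of_continuousOn_rect hu.continuousOn_space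
  obtain ⟨L, hL⟩ := isCompact_Icc.exists_bound_of_continuousOn
    (s := Icc (-1 : ℝ) 1) hf.continuous_deriv.continuousOn
  obtain ⟨C, hC⟩ := hu.exists_energy_deriv_le hf hab hκ hκb
  have hL0 : 0 ≤ L := (norm_nonneg _).trans (hL 0 (by simp))
  have h0I : (0 : ℝ) ∈ Icc 0 τ := left_mem_Icc.2 hτ
  have hτI : τ ∈ Icc 0 τ := right_mem_Icc.2 hτ
  set R : ℝ := max B 1 with hR
  have hpR : ∀ x ∈ Icc a b, ∀ t ∈ Icc 0 τ, -R ≤ p x t := fun x hx t ht =>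
    (neg_le_neg (le_max_left B 1)).trans (abs_le.1 (hB x hx t ht)).1
  obtain ⟨ρ, hρ0, hρ1, hρ⟩ : ∃ ρ, 0 ≤ ρ ∧ ρ < 1 ∧ ∀ x ∈ Icc a b, p x 0 ≤ ρ := by
    obtain ⟨x, hx, hmax⟩ := isCompact_Icc.exists_isMaxOn (nonempty_Icc.2 hab)
      (continuousOn_slice_left hu.continuousOn_space h0I)
    exact ⟨max (p x 0) 0, le_max_right _ _, max_lt (h0 x hx) one_pos, fun y hy =>
      (hmax hy).trans (le_max_left _ _)⟩
  set η : ℝ → ℝ := fun x => Real.sin (κ * (x - a)) ^ 4 with hη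
  have hηc : Continuous η := by fun_prop
  have hη0 : ∀ x, 0 ≤ η x := fun x => by positivity
  have hη1 : ∀ x, η x ≤ 1 := fun x => by
    have := pow_le_one₀ (n := 2) (sq_nonneg _) (Real.sin_sq_le_one (κ * (x - a)))
    simpa [hη, ← pow_mul] using this
  have hdη : ∀ x, HasDerivAt η
      (4 * Real.sin (κ * (x - a)) ^ 3 * (κ * Real.cos (κ * (x - a)))) x := fun x => by
    refine ((((hasDerivAt_id x).sub_const a).const_mul κ).sin.pow 4).congr_deriv ?_
    simp only [id]
    push_cast
    ring
  set C₀ : ℝ := (b - a) * ((ρ + R) * ((f 1 - f ρ) ^ 2)⁻¹) with hC₀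
  set K : ℝ := 2 * κ ^ 2 * L with hK
  set C₁ : ℝ := 2 * κ ^ 2 * ((f 1)⁻¹ * (b - a)) + C with hC₁
  refine ⟨L * gronwallBound C₀ K C₁ (τ - 0) + (f 1)⁻¹ * (b - a), fun ε hε => ?_⟩
  set Φ : ℝ → ℝ := fun σ => ∫ y in -R..σ, ((f 1 - f (max y (-1)) + ε) ^ 2)⁻¹ with hΦ
  have hΦc : Continuous Φ := continuous_primitive
    (fun _ _ => (hf.continuous_inv_sq_gap hε).intervalIntegrable _ _) _
  have hΦη : ContinuousOn (fun z : ℝ × ℝ => Φ (p z.1 z.2) * η z.1) (Icc a b ×ˢ Icc 0 τ) :=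
    (hu.continuousOn_comp hΦc).mul (hηc.comp continuous_fst).continuousOn
  have hfc := hf.continuous
  have hgap : ContinuousOn (fun z : ℝ × ℝ => η z.1 / (f 1 - f (max (p z.1 z.2) (-1)) + ε))
      (Icc a b ×ˢ Icc 0 τ) :=
    (hηc.comp continuous_fst).continuousOn.div
      (hu.continuousOn_comp (g := fun σ => f 1 - f (max σ (-1)) + ε) (by fun_prop))
      fun z _ => (add_pos_of_nonneg_of_pos (hf.gap_nonneg _) hε).ne'
  have hle : ∀ t ∈ Icc 0 τ, ∫ x in a..b, η x / (f 1 - f (max (p x t) (-1)) + ε)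
      ≤ L * (∫ x in a..b, Φ (p x t) * η x) + (f 1)⁻¹ * (b - a) := by
    intro t ht
    have hi := intervalIntegrable_slice (F := fun x t => Φ (p x t) * η x) hab hΦη ht
    have := integral_mono_on hab
      (intervalIntegrable_slice (F := fun x t => η x / (f 1 - f (max (p x t) (-1)) + ε))
        hab hgap ht)
      ((hi.const_mul L).add (intervalIntegrable_const (c := (f 1)⁻¹))) fun x hx => by
        have h1 := hf.inv_gap_le hε hL (le_max_right B 1) (hpR x hx t ht)
        have h2 : η x * (f 1)⁻¹ ≤ (f 1)⁻¹ :=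
          mul_le_of_le_one_left (inv_nonneg.2 hf.apply_one_pos.le) (hη1 x)
        have h3 := mul_le_mul_of_nonneg_left h1 (hη0 x)
        rw [div_eq_mul_inv]
        refine h3.trans ?_
        rw [mul_add]
        refine add_le_add (le_of_eq ?_) h2
        simp only [hΦ]
        ring
    rw [intervalIntegral.integral_add (hi.const_mul L) intervalIntegrable_const,
      intervalIntegral.integral_const_mul, intervalIntegral.integral_const, smul_eq_mul] at this
    linarith
  have hinit : ∫ x in a..b, Φ (p x 0) * η x ≤ C₀ := by
    have := integral_mono_on hab
      (intervalIntegrable_slice (F := fun x t => Φ (p x t) * η x) hab hΦη h0I)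
      (intervalIntegrable_const (c := (ρ + R) * ((f 1 - f ρ) ^ 2)⁻¹)) fun x hx =>
        (mul_le_of_le_one_right (IsPeronaMalikFlux.integral_inv_sq_gap_nonneg f
          (hpR x hx 0 h0I)) (hη1 x)).trans
          (hf.integral_inv_sq_gap_le hε (hpR x hx 0 h0I) (hρ x hx) hρ0 hρ1)
    rwa [intervalIntegral.integral_const, smul_eq_mul] at this
  have hgron := le_gronwallBound_of_liminf_deriv_right_le
    (f := fun t => ∫ x in a..b, Φ (p x t) * η x) (K := K) (ε := C₁) (δ := C₀)
    (continuousOn_integral_slice (F := fun x t => Φ (p x t) * η x) hab hΦη)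
    (fun s hs r hr => by
      have := ((hu.tendsto_slope_energy hf hab hε hdη (by fun_prop) hη0 (R := -R)
        (by simp [hη]) (by simp [hη, hκb]) hs).eventually_lt_const hr).frequently
      simpa only [slope_def_field, div_eq_inv_mul] using this)
    hinit
    (fun s hs => by
      have hsI := Ico_subset_Icc_self hs
      have h1 := hC ε hε s hsI
      have h2 := mul_le_mul_of_nonneg_left (hle s hsI) (by positivity : 0 ≤ 2 * κ ^ 2)
      simp only [hK, hC₁]
      linarith) τ hτI
  exact (hle τ hτI).trans (by gcongr)

/-- If the slope is initially below one on `[a, b]`, it cannot reach one inside `(a, b)`. -/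
theorem apply_ne_one (hu : IsClassicalSolutionOn f u p q a b τ) (hf : IsPeronaMalikFlux f)
    (hτ : 0 ≤ τ) (h0 : ∀ x ∈ Icc a b, p x 0 < 1) {x₀ : ℝ} (hx₀ : x₀ ∈ Ioo a b) :
    p x₀ τ ≠ 1 := by
  intro h
  have hab : 0 < b - a := by linarith [hx₀.1, hx₀.2]
  have hτI : τ ∈ Icc 0 τ := right_mem_Icc.2 hτ
  have hfc := hf.continuous
  have hκ : 0 < Real.pi / (b - a) := div_pos Real.pi_pos hab
  obtain ⟨C, hC⟩ := hu.exists_integral_div_gap_le hf (sub_pos.1 hab).le hτ h0 hκ.le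
    (by rw [div_mul_cancel₀ _ hab.ne', Real.sin_pi])
  have hw : ContinuousOn (fun x => f 1 - f (max (p x τ) (-1))) (Icc a b) :=
    continuousOn_slice_left (F := fun x t => f 1 - f (max (p x t) (-1)))
      (hu.continuousOn_comp (g := fun σ => f 1 - f (max σ (-1))) (by fun_prop)) hτI
  refine not_forall_integral_div_add_le (C := C) hx₀ hw (fun x _ => hf.gap_nonneg _)
    (η := fun x => Real.sin (Real.pi / (b - a) * (x - a)) ^ 4) (by fun_prop)
    (fun x => by positivity) (pow_pos (Real.sin_pos_of_pos_of_lt_pi ?_ ?_) 4) ?_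
    fun ε hε => hC ε hε.1
  · exact mul_pos hκ (sub_pos.2 hx₀.1)
  · rw [div_mul_eq_mul_div, div_lt_iff₀ hab]
    exact mul_lt_mul_of_pos_left (by linarith [hx₀.2]) Real.pi_pos
  · have := ((hu.hasDerivAt_comp_max hf.isLocalExtr_neg_one (Ioo_subset_Icc_self hx₀)
      hτI).const_sub (f 1)).isBigO_sub
    simpa [h] using this

end IsClassicalSolutionOn

/-- Slopes initially below one on an interval stay below one there. -/
theorem IsPeronaMalikFlux.slope_lt_one {f : ℝ → ℝ} (hf : IsPeronaMalikFlux f)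
    {u p q : ℝ → ℝ → ℝ} {c d T : ℝ}
    (hp : ∀ x t : ℝ, x ∈ Ioo c d → t ∈ Ico 0 T → HasDerivAt (fun y => u y t) (p x t) x)
    (hq : ∀ x t : ℝ, x ∈ Ioo c d → t ∈ Ico 0 T →
      HasDerivWithinAt (fun s => u x s) (q x t) (Ico 0 T) t)
    (hpC : ContinuousOn (fun z : ℝ × ℝ => p z.1 z.2) (Ioo c d ×ˢ Ico 0 T))
    (hqC : ContinuousOn (fun z : ℝ × ℝ => q z.1 z.2) (Ioo c d ×ˢ Ico 0 T))
    (heq : ∀ x t : ℝ, x ∈ Ioo c d → t ∈ Ico 0 T → HasDerivAt (fun y => f (p y t)) (q x t) x)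
    (h0 : ∀ x ∈ Ioo c d, p x 0 < 1) {x t : ℝ} (hx : x ∈ Ioo c d) (ht : t ∈ Ico 0 T) :
    p x t < 1 := by
  by_contra! h
  obtain ⟨τ, hτ, hτ1⟩ : ∃ τ ∈ Icc 0 t, p x τ = 1 := by
    refine intermediate_value_Icc ht.1 (f := fun s => p x s) ?_ ⟨(h0 x hx).le, h⟩
    exact hpC.comp (f := fun s => (x, s)) (by fun_prop) fun s hs =>
      ⟨hx, hs.1, hs.2.trans_lt ht.2⟩
  obtain ⟨a, hca, hax⟩ := exists_between hx.1
  obtain ⟨b, hxb, hbd⟩ := exists_between hx.2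
  have hI : Icc a b ⊆ Ioo c d := Icc_subset_Ioo hca hbd
  have hJ : Icc 0 τ ⊆ Ico 0 T := Icc_subset_Ico_right (hτ.2.trans_lt ht.2)
  have hu : IsClassicalSolutionOn f u p q a b τ :=
    { hasDerivAt_space := fun y hy s hs => hp y s (hI hy) (hJ hs)
      hasDerivWithinAt_time := fun y hy s hs => (hq y s (hI hy) (hJ hs)).mono hJ
      continuousOn_space := hpC.mono (prod_mono hI hJ)
      continuousOn_time := hqC.mono (prod_mono hI hJ)
      hasDerivAt_flux := fun y hy s hs => heq y s (hI hy) (hJ hs)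
      continuousAt_space := fun y hy s hs =>
        (hpC.comp (f := fun y => (y, s)) (by fun_prop) fun y hy => ⟨hy, hJ hs⟩).continuousAt
          (Ioo_mem_nhds (hI hy).1 (hI hy).2) }
  exact hu.apply_ne_one hf hτ.1 (fun y hy => h0 y (hI hy)) ⟨hax, hxb⟩ hτ1

theorem isPeronaMalikFlux_deriv {φ : ℝ → ℝ} (hφ : ContDiff ℝ 2 φ)
    (hφeven : ∀ σ : ℝ, φ (-σ) = φ σ)
    (hφ2pos : ∀ σ : ℝ, 0 ≤ σ → σ < 1 → 0 < deriv (deriv φ) σ)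
    (hφ2neg : ∀ σ : ℝ, 1 < σ → deriv (deriv φ) σ < 0) : IsPeronaMalikFlux (deriv φ) := by
  have hodd : ∀ σ, deriv φ (-σ) = -deriv φ σ := fun σ => by
    have h := deriv_comp_neg φ σ
    simp only [hφeven] at h
    rw [h, neg_neg]
  have hC1 : ContDiff ℝ 1 (deriv φ) := hφ.deriv'
  have heven : ∀ σ, deriv (deriv φ) (-σ) = deriv (deriv φ) σ := fun σ => by
    have h := deriv_comp_neg (deriv φ) σ
    simp only [hodd] at h
    rw [deriv.fun_neg] at h
    exact (neg_injective h).symm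
  have hanti : AntitoneOn (deriv φ) (Ici 1) := by
    refine antitoneOn_of_deriv_nonpos (convex_Ici 1) hC1.continuous.continuousOn
      (hC1.differentiable one_ne_zero).differentiableOn fun σ hσ => ?_
    rw [interior_Ici] at hσ
    exact (hφ2neg σ hσ).le
  refine ⟨hC1.differentiable one_ne_zero, hC1.continuous_deriv le_rfl, hodd, ?_, ?_, hanti⟩
  · refine strictMonoOn_of_deriv_pos (convex_Icc _ _) hC1.continuous.continuousOn fun σ hσ => ?_
    rw [interior_Icc] at hσ
    rcases le_total 0 σ with h | h
    · exact hφ2pos σ h hσ.2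
    · rw [← heven]
      exact hφ2pos (-σ) (by linarith) (by linarith [hσ.1])
  · intro σ hσ ρ hρ h
    have h1 : (1 : ℝ) ≤ -σ := le_neg.1 hσ
    have h2 : (1 : ℝ) ≤ -ρ := le_neg.1 hρ
    have := hanti (mem_Ici.2 h2) (mem_Ici.2 h1) (neg_le_neg h)
    rw [hodd, hodd] at this
    linarith

/-- Theorem 1.1 / `thm:PM1`.
In dimension one, if a `C¹` classical solution of the Perona–Malik-type equation
`u_t = (φ'(u_x))_x` on `(x₁,x₂)×[0,T)` is subcritical on `(x₃,x₄)` at time `0`,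
then it is subcritical on `(x₃,x₄)` for all times. -/
theorem subcritical_region_persists_dim_one
    (φ : ℝ → ℝ) (hφ : ContDiff ℝ (⊤ : ℕ∞) φ) (hφeven : ∀ σ : ℝ, φ (-σ) = φ σ)
    (hφ2pos : ∀ σ : ℝ, 0 ≤ σ → σ < 1 → 0 < deriv (deriv φ) σ)
    (hφ2one : deriv (deriv φ) 1 = 0)
    (hφ2neg : ∀ σ : ℝ, 1 < σ → deriv (deriv φ) σ < 0)
    (x₁ x₂ x₃ x₄ T : ℝ)
    (h13 : x₁ ≤ x₃) (h34 : x₃ < x₄) (h42 : x₄ ≤ x₂) (hT : 0 < T)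
    (u ux ut : ℝ → ℝ → ℝ)
    -- `u` is of class `C¹` on `(x₁,x₂)×[0,T)`: the partial derivatives exist ...
    (hux : ∀ x t : ℝ, x ∈ Set.Ioo x₁ x₂ → t ∈ Set.Ico 0 T →
      HasDerivAt (fun y => u y t) (ux x t) x)
    (hut : ∀ x t : ℝ, x ∈ Set.Ioo x₁ x₂ → t ∈ Set.Ico 0 T →
      HasDerivWithinAt (fun s => u x s) (ut x t) (Set.Ico 0 T) t)
    -- ... and `u`, `u_x`, `u_t` are continuous on `(x₁,x₂)×[0,T)`
    (huC : ContinuousOn (fun p : ℝ × ℝ => u p.1 p.2) (Set.Ioo x₁ x₂ ×ˢ Set.Ico 0 T))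
    (huxC : ContinuousOn (fun p : ℝ × ℝ => ux p.1 p.2) (Set.Ioo x₁ x₂ ×ˢ Set.Ico 0 T))
    (hutC : ContinuousOn (fun p : ℝ × ℝ => ut p.1 p.2) (Set.Ioo x₁ x₂ ×ˢ Set.Ico 0 T))
    -- the equation: `x ↦ φ'(u_x(x,t))` is differentiable and its derivative is `u_t(x,t)`
    (heq : ∀ x t : ℝ, x ∈ Set.Ioo x₁ x₂ → t ∈ Set.Ico 0 T →
      HasDerivAt (fun y => deriv φ (ux y t)) (ut x t) x)
    -- the initial datum is subcritical on `(x₃,x₄)`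
    (hinit : ∀ x ∈ Set.Ioo x₃ x₄, |ux x 0| < 1) :
    ∀ x t : ℝ, x ∈ Set.Ioo x₃ x₄ → t ∈ Set.Ico 0 T → |ux x t| < 1 := by
  have hf := isPeronaMalikFlux_deriv (hφ.of_le (WithTop.coe_le_coe.2 le_top)) hφeven hφ2pos hφ2neg
  have hI : Set.Ioo x₃ x₄ ⊆ Set.Ioo x₁ x₂ := Set.Ioo_subset_Ioo h13 h42
  have hI' : Set.Ioo x₃ x₄ ×ˢ Set.Ico 0 T ⊆ Set.Ioo x₁ x₂ ×ˢ Set.Ico 0 T :=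
    Set.prod_mono hI subset_rfl
  intro x t hx ht
  refine abs_lt.2 ⟨neg_lt.1 ?_, ?_⟩
  · exact hf.slope_lt_one (u := fun x t => -u x t) (p := fun x t => -ux x t)
      (q := fun x t => -ut x t) (fun y s hy hs => (hux y s (hI hy) hs).neg)
      (fun y s hy hs => (hut y s (hI hy) hs).neg) (huxC.mono hI').neg (hutC.mono hI').neg
      (fun y s hy hs => by simpa only [hf.odd] using (heq y s (hI hy) hs).fun_neg)
      (fun y hy => neg_lt.1 (abs_lt.1 (hinit y hy)).1) hx ht
  · exact hf.slope_lt_one (fun y s hy hs => hux y s (hI hy) hs)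
      (fun y s hy hs => hut y s (hI hy) hs) (huxC.mono hI') (hutC.mono hI')
      (fun y s hy hs => heq y s (hI hy) hs) (fun y hy => (abs_lt.1 (hinit y hy)).2) hx ht
end

section
/- Let x₁ < x₂ and T > 0 be real numbers, and let u ∈ C¹((x₁,x₂)×[0,T)) be a classical solution of u_t = (φ'(u_x))_x on (x₁,x₂)×[0,T). Then subcritical regions do not shrink: for every 0 ≤ s ≤ t < T and every x₀ ∈ (x₁,x₂), if |u_x(x₀,s)| < 1 then |u_x(x₀,t)| < 1. -/
section ClassicalSolution

open Set Filter Topology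

theorem HasDerivAt.eventually_nhdsGT_lt {f : ℝ → ℝ} {f' x : ℝ} (h : HasDerivAt f f' x)
    (hf' : 0 < f') : ∀ᶠ y in 𝓝[>] x, f x < f y := by
  have h1 := (hasDerivAt_iff_tendsto_slope_left_right.1 h).2.eventually (eventually_gt_nhds hf')
  filter_upwards [h1, self_mem_nhdsWithin] with y hy hxy
  rw [slope_def_field] at hy
  have hxy' : 0 < y - x := sub_pos.2 hxy
  have := (div_pos_iff_of_pos_right hxy').1 hy
  linarith

theorem HasDerivAt.eventually_nhdsLT_lt {f : ℝ → ℝ} {f' x : ℝ} (h : HasDerivAt f f' x)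
    (hf' : 0 < f') : ∀ᶠ y in 𝓝[<] x, f y < f x := by
  have h1 := (hasDerivAt_iff_tendsto_slope_left_right.1 h).1.eventually (eventually_gt_nhds hf')
  filter_upwards [h1, self_mem_nhdsWithin] with y hy hxy
  rw [slope_comm, slope_def_field] at hy
  have hxy' : 0 < x - y := sub_pos.2 hxy
  have := (div_pos_iff_of_pos_right hxy').1 hy
  linarith

/-- If `D` has a local maximum at `y`, and `D'` is positive wherever `f` is positive near the
zero `y` of `f`, then `f' y ≤ 0`. -/
theorem IsLocalMax.nonpos_of_pos_imp_deriv_pos {D d f : ℝ → ℝ} {f' y : ℝ}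
    (hmax : IsLocalMax D y) (hD : ∀ᶠ ξ in 𝓝 y, HasDerivAt D (d ξ) ξ)
    (hf : HasDerivAt f f' y) (hf0 : f y = 0) (hsgn : ∀ᶠ ξ in 𝓝 y, 0 < f ξ → 0 < d ξ) :
    f' ≤ 0 := by
  by_contra! hpos
  have hright : ∀ᶠ ξ in 𝓝[>] y, D ξ ≤ D y ∧ HasDerivAt D (d ξ) ξ ∧ 0 < d ξ := by
    filter_upwards [nhdsWithin_le_nhds hmax, nhdsWithin_le_nhds hD, nhdsWithin_le_nhds hsgn,
      hf.eventually_nhdsGT_lt hpos] with ξ h1 h2 h3 h4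
    exact ⟨h1, h2, h3 (hf0 ▸ h4)⟩
  obtain ⟨b', hb', hsub⟩ := mem_nhdsGT_iff_exists_Ioo_subset.1 hright
  obtain ⟨b, hyb, hbb'⟩ := exists_between (mem_Ioi.1 hb')
  have hcont : ContinuousOn D (Icc y b) := by
    intro ξ hξ
    rcases hξ.1.eq_or_lt with rfl | h
    · exact hD.self_of_nhds.continuousAt.continuousWithinAt
    · exact (hsub ⟨h, hξ.2.trans_lt hbb'⟩).2.1.continuousAt.continuousWithinAt
  obtain ⟨η, hη, heq⟩ := exists_hasDerivAt_eq_slope D d hyb hcont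
    fun ξ hξ => (hsub ⟨hξ.1, hξ.2.trans hbb'⟩).2.1
  have h1 := (hsub ⟨hη.1, hη.2.trans hbb'⟩).2.2
  have h2 := (hsub ⟨hyb, hbb'⟩).1
  rw [heq, div_pos_iff_of_pos_right (sub_pos.2 hyb)] at h1
  linarith

theorem exists_continuous_inverse_of_strictMonoOn_Icc {Φ : ℝ → ℝ}
    (hc : ContinuousOn Φ (Icc 0 1)) (hm : StrictMonoOn Φ (Icc 0 1)) :
    ∃ g : ℝ → ℝ, Continuous g ∧ ∀ σ ∈ Icc (0 : ℝ) 1, g (Φ σ) = σ := by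
  let F : ℝ → ℝ := fun σ => IccExtend zero_le_one (fun τ : Icc (0 : ℝ) 1 => Φ τ) σ +
    (σ - max 0 (min 1 σ))
  have hF : ∀ σ ∈ Icc (0 : ℝ) 1, F σ = Φ σ := by
    intro σ hσ
    simp only [F, IccExtend_of_mem _ _ hσ, min_eq_right hσ.2, max_eq_right hσ.1, sub_self,
      add_zero]
  have hFl : ∀ σ ≤ 0, F σ = Φ 0 + σ := by
    intro σ hσ
    simp only [F, IccExtend_of_le_left _ _ hσ, min_eq_right (hσ.trans zero_le_one),
      max_eq_left hσ, sub_zero]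
  have hFr : ∀ σ, 1 ≤ σ → F σ = Φ 1 + (σ - 1) := by
    intro σ hσ
    simp only [F, IccExtend_of_right_le _ _ hσ, min_eq_left hσ, max_eq_right zero_le_one]
  have hFc : Continuous F :=
    (continuousOn_iff_continuous_domRestrict.1 hc).Icc_extend'.add (by fun_prop)
  have hFm : StrictMono F := by
    have h1 : StrictMonoOn F (Iic 0) := fun a ha b hb hab => by
      rw [hFl a ha, hFl b hb]; linarith
    have h2 : StrictMonoOn F (Icc 0 1) := fun a ha b hb hab => by
      rw [hF a ha, hF b hb]; exact hm ha hb hab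
    have h3 : StrictMonoOn F (Ici 1) := fun a ha b hb hab => by
      rw [hFr a ha, hFr b hb]; linarith
    have h4 : StrictMonoOn F (Iic 1) := by
      have := h1.union h2 (c := 0) isGreatest_Iic (isLeast_Icc zero_le_one)
      rwa [Iic_union_Icc_eq_Iic zero_le_one] at this
    exact h4.Iic_union_Ici h3
  have hFs : Function.Surjective F := by
    refine hFc.surjective ?_ ?_
    · refine (tendsto_atTop_add_const_right atTop (Φ 1 - 1) tendsto_id).congr' ?_
      filter_upwards [eventually_ge_atTop 1] with σ hσ
      rw [hFr σ hσ, id]; ring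
    · refine (tendsto_atBot_add_const_right atBot (Φ 0) tendsto_id).congr' ?_
      filter_upwards [eventually_le_atBot 0] with σ hσ
      rw [hFl σ hσ, id]; ring
  refine ⟨(hFm.orderIsoOfSurjective F hFs).symm, OrderIso.continuous _, fun σ hσ => ?_⟩
  rw [← hF σ hσ]
  exact hFm.orderIsoOfSurjective_symm_apply_self F hFs σ

/-- `u` is a classical solution of `u_t = (Φ(u_x))_x` on `(x₁,x₂)×[0,T)`, with `p = u_x` and
`w = u_t`. -/
structure IsClassicalSolution (Φ : ℝ → ℝ) (x₁ x₂ T : ℝ) (u p w : ℝ → ℝ → ℝ) : Prop where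
  hasDerivAt_space : ∀ x ∈ Ioo x₁ x₂, ∀ t ∈ Ico 0 T, HasDerivAt (fun y => u y t) (p x t) x
  hasDerivWithinAt_time : ∀ x ∈ Ioo x₁ x₂, ∀ t ∈ Ico 0 T,
    HasDerivWithinAt (fun s => u x s) (w x t) (Ico 0 T) t
  continuousOn : ContinuousOn (fun z : ℝ × ℝ => u z.1 z.2) (Ioo x₁ x₂ ×ˢ Ico 0 T)
  continuousOn_slope : ContinuousOn (fun z : ℝ × ℝ => p z.1 z.2) (Ioo x₁ x₂ ×ˢ Ico 0 T)
  hasDerivAt_flux : ∀ x ∈ Ioo x₁ x₂, ∀ t ∈ Ico 0 T, HasDerivAt (fun y => Φ (p y t)) (w x t) x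

namespace IsClassicalSolution

variable {Φ : ℝ → ℝ} {x₁ x₂ T : ℝ} {u p w : ℝ → ℝ → ℝ}

theorem continuousAt_slope_space (h : IsClassicalSolution Φ x₁ x₂ T u p w) {x t : ℝ}
    (hx : x ∈ Ioo x₁ x₂) (ht : t ∈ Ico 0 T) : ContinuousAt (fun y => p y t) x := by
  have h1 : ContinuousOn (fun y => p y t) (Ioo x₁ x₂) :=
    h.continuousOn_slope.comp (f := fun y : ℝ => (y, t)) (by fun_prop) fun y hy => ⟨hy, ht⟩
  exact h1.continuousAt (isOpen_Ioo.mem_nhds hx)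

theorem continuousOn_slope_time (h : IsClassicalSolution Φ x₁ x₂ T u p w) {x : ℝ}
    (hx : x ∈ Ioo x₁ x₂) : ContinuousOn (fun t => p x t) (Ico 0 T) :=
  h.continuousOn_slope.comp (f := fun t : ℝ => (x, t)) (by fun_prop) fun _ ht => ⟨hx, ht⟩

/-- Comparison of the slope `p` of a solution with a supersolution `q` of the slope equation,
equal to `1` on the lateral boundary. -/
theorem slope_le_of_supersolution (h : IsClassicalSolution Φ x₁ x₂ T u p w)
    (hΦ : StrictMonoOn Φ (Icc 0 1)) {l r s t₁ : ℝ} (hl : x₁ < l) (hr : r < x₂)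
    (hs : 0 ≤ s) (hst : s < t₁) (ht₁ : t₁ < T)
    (hp : ∀ x ∈ Icc l r, ∀ t ∈ Ico s t₁, p x t < 1)
    {q Vx : ℝ → ℝ → ℝ} (hq : Continuous fun z : ℝ × ℝ => q z.1 z.2)
    (hq0 : ∀ x ∈ Icc l r, ∀ t ∈ Ico s t₁, 0 < q x t)
    (hql : ∀ t ∈ Ico s t₁, q l t = 1) (hqr : ∀ t ∈ Ico s t₁, q r t = 1)
    (hV : ∀ x ∈ Ioo l r, ∀ t ∈ Ico s t₁, HasDerivAt (fun y => Φ (q y t)) (Vx x t) x)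
    (hsuper : ∀ x y, l < x → x < y → y < r → ∀ t ∈ Ioo s t₁, ∃ c, Vx y t - Vx x t < c ∧
      ∀ᶠ τ in 𝓝[<] t, c * (t - τ) ≤ ∫ ξ in x..y, (q ξ t - q ξ τ))
    (hinit : ∀ x ∈ Icc l r, p x s ≤ q x s) :
    ∀ x ∈ Icc l r, ∀ t ∈ Icc s t₁, p x t ≤ q x t := by
  have hI : ∀ x ∈ Icc l r, x ∈ Ioo x₁ x₂ := fun x hx => ⟨hl.trans_le hx.1, hx.2.trans_lt hr⟩
  have hJ : ∀ t ∈ Icc s t₁, t ∈ Ico 0 T := fun t ht => ⟨hs.trans ht.1, ht.2.trans_lt ht₁⟩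
  have hJ' : ∀ t ∈ Ico s t₁, t ∈ Ico 0 T := fun t ht => hJ t (Ico_subset_Icc_self ht)
  have hqx : ∀ t, Continuous fun x => q x t := fun t =>
    hq.comp (by fun_prop : Continuous fun x : ℝ => (x, t))
  suffices key : ∀ x ∈ Icc l r, ∀ t ∈ Ico s t₁, p x t ≤ q x t by
    intro x hx t ht
    have hcl : t ∈ closure (Ico s t₁) := by rwa [closure_Ico hst.ne]
    have hsub : Icc s t₁ ⊆ Ico 0 T := hJ
    refine ContinuousWithinAt.closure_le (s := Ico s t₁) (f := fun t => p x t) hcl ?_ ?_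
      fun τ hτ => key x hx τ hτ
    · exact ((h.continuousOn_slope_time (hI x hx)) t (hJ t ht)).mono
        (Ico_subset_Icc_self.trans hsub)
    · exact (hq.comp (by fun_prop : Continuous fun τ : ℝ => (x, τ))).continuousWithinAt
  intro x' hx' t' ht'
  by_contra! hcontra
  set D : ℝ → ℝ → ℝ := fun y t => u y t - ∫ ξ in l..y, q ξ t with hD
  have hDx : ∀ x ∈ Icc l r, ∀ t ∈ Ico s t₁, HasDerivAt (fun y => D y t) (p x t - q x t) x :=
    fun x hx t ht => (h.hasDerivAt_space x (hI x hx) t (hJ' t ht)).sub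
      (intervalIntegral.integral_hasDerivAt_right ((hqx t).intervalIntegrable _ _)
        ((hqx t).stronglyMeasurableAtFilter _ _) (hqx t).continuousAt)
  have hDc : ContinuousOn (fun z : ℝ × ℝ => D z.1 z.2) (Icc l r ×ˢ Ico s t₁) := by
    refine (h.continuousOn.mono (prod_mono hI hJ')).sub (Continuous.continuousOn ?_)
    exact intervalIntegral.continuous_parametric_intervalIntegral_of_continuous
      (f := fun (z : ℝ × ℝ) ξ => q ξ z.2)
      (hq.comp (by fun_prop : Continuous fun z : (ℝ × ℝ) × ℝ => (z.2, z.1.2))) continuous_fst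
  set S : Set ((ℝ × ℝ) × ℝ) := ((Icc l r ×ˢ Icc l r) ×ˢ Icc s t') ∩ {z | z.1.1 ≤ z.1.2} with hS
  have hScpt : IsCompact S :=
    ((isCompact_Icc.prod isCompact_Icc).prod isCompact_Icc).inter_right
      (isClosed_le (by fun_prop) (by fun_prop))
  have ht'sub : ∀ t ∈ Icc s t', t ∈ Ico s t₁ := fun t ht => ⟨ht.1, ht.2.trans_lt ht'.2⟩
  have hHc : ContinuousOn (fun z : (ℝ × ℝ) × ℝ => D z.1.2 z.2 - D z.1.1 z.2) S := by
    refine ContinuousOn.sub ?_ ?_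
    · exact hDc.comp (f := fun z : (ℝ × ℝ) × ℝ => (z.1.2, z.2)) (by fun_prop)
        fun z hz => ⟨hz.1.1.2, ht'sub _ hz.1.2⟩
    · exact hDc.comp (f := fun z : (ℝ × ℝ) × ℝ => (z.1.1, z.2)) (by fun_prop)
        fun z hz => ⟨hz.1.1.1, ht'sub _ hz.1.2⟩
  have hlr : l ≤ r := hx'.1.trans hx'.2
  obtain ⟨⟨⟨x, y⟩, t⟩, hmem, hmax⟩ := hScpt.exists_isMaxOn
    ⟨((l, l), s), ⟨⟨⟨left_mem_Icc.2 hlr, left_mem_Icc.2 hlr⟩, left_mem_Icc.2 ht'.1⟩,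
      le_refl l⟩⟩ hHc
  have hmax' : ∀ a ∈ Icc l r, ∀ b ∈ Icc l r, a ≤ b → ∀ τ ∈ Icc s t',
      D b τ - D a τ ≤ D y t - D x t := fun a ha b hb hab τ hτ =>
    hmax (show ((a, b), τ) ∈ S from ⟨⟨⟨ha, hb⟩, hτ⟩, hab⟩)
  obtain ⟨⟨⟨hx, hy⟩, ht⟩, hxy⟩ := hmem
  change x ∈ Icc l r at hx
  change y ∈ Icc l r at hy
  change t ∈ Icc s t' at ht
  change x ≤ y at hxy
  have htI := ht'sub t ht
  -- the maximum is positive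
  have hpos : 0 < D y t - D x t := by
    have hx'r : x' < r := by
      refine hx'.2.lt_of_ne fun hE => ?_
      have h1 := hp x' hx' t' ht'
      rw [hE] at h1 hcontra
      rw [hqr t' ht'] at hcontra
      exact lt_asymm h1 hcontra
    have h1 := (hDx x' hx' t' ht').eventually_nhdsGT_lt (sub_pos.2 hcontra)
    obtain ⟨b, hb, hbI⟩ := (h1.and (Ioo_mem_nhdsGT hx'r)).exists
    have h2 := hmax' x' hx' b ⟨hx'.1.trans hbI.1.le, hbI.2.le⟩ hbI.1.le t' (right_mem_Icc.2 ht'.1)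
    linarith
  have hxy : x < y := hxy.lt_of_ne fun hE => by rw [hE, sub_self] at hpos; exact lt_irrefl _ hpos
  -- the maximum is not attained at the initial time
  have hts : s < t := by
    refine ht.1.lt_of_ne fun hE => ?_
    have hanti : AntitoneOn (fun y => D y s) (Icc l r) := by
      refine antitoneOn_of_deriv_nonpos (convex_Icc l r)
        (fun z hz => (hDx z hz s ⟨le_rfl, hst⟩).continuousAt.continuousWithinAt)
        (fun z hz => (hDx z (interior_subset hz) s
          ⟨le_rfl, hst⟩).differentiableAt.differentiableWithinAt) fun z hz => ?_
      rw [(hDx z (interior_subset hz) s ⟨le_rfl, hst⟩).deriv]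
      exact sub_nonpos.2 (hinit z (interior_subset hz))
    have := hanti hx hy hxy.le
    simp only [hE] at this
    linarith
  -- the maximum is not attained on the lateral boundary
  have hyr : y < r := by
    refine hy.2.lt_of_ne fun hE => ?_
    have h1 := hDx y hy t htI
    have h2 : p y t - q y t < 0 := by
      have := hp y hy t htI
      rw [hE] at this ⊢
      rw [hqr t htI]; linarith
    obtain ⟨b, hb, hbI⟩ :=
      ((h1.neg.eventually_nhdsLT_lt (neg_pos.2 h2)).and (Ioo_mem_nhdsLT hxy)).exists
    have h3 := hmax' x hx b ⟨hx.1.trans hbI.1.le, hbI.2.le.trans hy.2⟩ hbI.1.le t ht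
    simp only [Pi.neg_apply] at hb
    linarith
  have hxl : l < x := by
    refine hx.1.lt_of_ne fun hE => ?_
    have h1 := hDx x hx t htI
    have h2 : p x t - q x t < 0 := by
      have := hp x hx t htI
      rw [← hE] at this ⊢
      rw [hql t htI]; linarith
    obtain ⟨b, hb, hbI⟩ :=
      ((h1.neg.eventually_nhdsGT_lt (neg_pos.2 h2)).and (Ioo_mem_nhdsGT hxy)).exists
    have h3 := hmax' b ⟨hx.1.trans hbI.1.le, hbI.2.le.trans hy.2⟩ y hy hbI.2.le t ht
    simp only [Pi.neg_apply] at hb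
    linarith
  have hymax : IsLocalMax (fun z => D z t) y := by
    filter_upwards [Ioo_mem_nhds hxy hyr] with b hb
    have := hmax' x hx b ⟨hx.1.trans hb.1.le, hb.2.le⟩ hb.1.le t ht
    linarith
  have hxmin : IsLocalMax (fun z => -D z t) x := by
    filter_upwards [Ioo_mem_nhds hxl hxy] with b hb
    have := hmax' b ⟨hb.1.le, hb.2.le.trans hy.2⟩ y hy hb.2.le t ht
    linarith
  have hqlt : ∀ z ∈ Icc l r, p z t = q z t → q z t ∈ Ioo (0 : ℝ) 1 := fun z hz hE =>
    ⟨hq0 z hz t htI, hE ▸ hp z hz t htI⟩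
  have hnear : ∀ z ∈ Ioo l r, p z t = q z t → ∀ᶠ ξ in 𝓝 z,
      p ξ t ∈ Icc (0 : ℝ) 1 ∧ q ξ t ∈ Icc (0 : ℝ) 1 := by
    intro z hz hE
    have hz' := Ioo_subset_Icc_self hz
    have h1 := hqlt z hz' hE
    filter_upwards [(h.continuousAt_slope_space (hI z hz') (hJ' t htI)).eventually_mem
      (isOpen_Ioo.mem_nhds (hE ▸ h1)), (hqx t).continuousAt.eventually_mem
      (isOpen_Ioo.mem_nhds h1)] with ξ h2 h3
    exact ⟨Ioo_subset_Icc_self h2, Ioo_subset_Icc_self h3⟩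
  have hyy : y ∈ Ioo l r := ⟨hxl.trans hxy, hyr⟩
  have hxx : x ∈ Ioo l r := ⟨hxl, hxy.trans hyr⟩
  have hpy : p y t = q y t := sub_eq_zero.1 (hymax.hasDerivAt_eq_zero (hDx y hy t htI))
  have hpx : p x t = q x t :=
    sub_eq_zero.1 (neg_eq_zero.1 (hxmin.hasDerivAt_eq_zero (hDx x hx t htI).neg))
  have hwy : w y t - Vx y t ≤ 0 := by
    refine hymax.nonpos_of_pos_imp_deriv_pos (d := fun z => p z t - q z t)
      (f := fun z => Φ (p z t) - Φ (q z t)) ?_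
      ((h.hasDerivAt_flux y (hI y hy) t (hJ' t htI)).sub (hV y hyy t htI)) (by simp [hpy]) ?_
    · filter_upwards [Ioo_mem_nhds hyy.1 hyy.2] with z hz
        using hDx z (Ioo_subset_Icc_self hz) t htI
    · filter_upwards [hnear y hyy hpy] with z hz hpos
      exact sub_pos.2 ((hΦ.lt_iff_lt hz.2 hz.1).1 (sub_pos.1 hpos))
  have hwx : -(w x t - Vx x t) ≤ 0 := by
    refine hxmin.nonpos_of_pos_imp_deriv_pos (d := fun z => -(p z t - q z t))
      (f := fun z => -(Φ (p z t) - Φ (q z t))) ?_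
      ((h.hasDerivAt_flux x (hI x hx) t (hJ' t htI)).sub (hV x hxx t htI)).neg
      (by simp [hpx]) ?_
    · filter_upwards [Ioo_mem_nhds hxx.1 hxx.2] with z hz
        using (hDx z (Ioo_subset_Icc_self hz) t htI).neg
    · filter_upwards [hnear x hxx hpx] with z hz hpos
      rw [neg_sub, sub_pos] at hpos ⊢
      exact (hΦ.lt_iff_lt hz.1 hz.2).1 hpos
  obtain ⟨c, hc, hcint⟩ := hsuper x y hxl hxy hyr t ⟨hts, htI.2⟩
  have hnhds : Ico 0 T ∈ 𝓝 t :=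
    Ico_mem_nhds (hs.trans_lt hts) (htI.2.trans ht₁)
  have hut := ((h.hasDerivWithinAt_time y (hI y hy) t (hJ' t htI)).hasDerivAt hnhds).sub
    ((h.hasDerivWithinAt_time x (hI x hx) t (hJ' t htI)).hasDerivAt hnhds)
  have hG := (((hasDerivAt_id t).const_mul c).sub hut).eventually_nhdsLT_lt (by linarith)
  obtain ⟨τ, ⟨hτ1, hτ2⟩, hτI⟩ := ((hG.and hcint).and (Ioo_mem_nhdsLT hts)).exists
  have hτmax := hmax' x hx y hy hxy.le τ ⟨hτI.1.le, hτI.2.le.trans ht.2⟩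
  have hint : ∀ τ, (∫ ξ in l..y, q ξ τ) - ∫ ξ in l..x, q ξ τ = ∫ ξ in x..y, q ξ τ := fun τ =>
    intervalIntegral.integral_interval_sub_left ((hqx τ).intervalIntegrable _ _)
      ((hqx τ).intervalIntegrable _ _)
  rw [intervalIntegral.integral_sub ((hqx t).intervalIntegrable _ _)
    ((hqx τ).intervalIntegrable _ _), ← hint t, ← hint τ] at hτ2
  simp only [Pi.sub_apply, id, hD] at hτ1 hτmax
  linarith

/-- A quantitative strong maximum principle: as long as the slope stays below `1` on `[l,r]`, the
flux stays below its maximum `Φ 1` by a positive multiple of the first sine mode of `[l,r]`. -/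
theorem exists_flux_le_sub_sin (h : IsClassicalSolution Φ x₁ x₂ T u p w)
    (hΦc : ContinuousOn Φ (Icc 0 1)) (hΦ : StrictMonoOn Φ (Icc 0 1)) {A : ℝ} (hA : 0 < A)
    (hΦA : ∀ a ∈ Icc (0 : ℝ) 1, ∀ b ∈ Icc (0 : ℝ) 1, a ≤ b → Φ b - Φ a ≤ A * (b - a))
    {l r s t₁ : ℝ} (hl : x₁ < l) (hlr : l < r) (hr : r < x₂)
    (hs : 0 ≤ s) (hst : s < t₁) (ht₁ : t₁ < T)
    (hp : ∀ x ∈ Icc l r, ∀ t ∈ Ico s t₁, p x t < 1) :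
    ∃ ε > 0, ∀ x ∈ Icc l r, p x t₁ ≤ 1 ∧
      (0 ≤ p x t₁ → Φ (p x t₁) ≤ Φ 1 - ε * Real.sin (Real.pi / (r - l) * (x - l))) := by
  have hrl : 0 < r - l := sub_pos.2 hlr
  obtain ⟨m, hm0, hm1, hm⟩ : ∃ m : ℝ, 0 < m ∧ m < 1 ∧ ∀ x ∈ Icc l r, p x s ≤ m := by
    obtain ⟨x, hx, hmax⟩ := isCompact_Icc.exists_isMaxOn (nonempty_Icc.2 hlr.le)
      (f := fun x => p x s) fun x hx => (h.continuousAt_slope_space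
        ⟨hl.trans_le hx.1, hx.2.trans_lt hr⟩ ⟨hs, hst.trans ht₁⟩).continuousWithinAt
    exact ⟨max (p x s) (1 / 2), by positivity, max_lt (hp x hx s ⟨le_rfl, hst⟩) (by norm_num),
      fun y hy => (hmax hy).trans (le_max_left _ _)⟩
  have hmI : m ∈ Icc (0 : ℝ) 1 := ⟨hm0.le, hm1.le⟩
  have h1I : (1 : ℝ) ∈ Icc (0 : ℝ) 1 := ⟨zero_le_one, le_rfl⟩
  obtain ⟨g, hgc, hg⟩ := exists_continuous_inverse_of_strictMonoOn_Icc hΦc hΦ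
  set k : ℝ := Real.pi / (r - l) with hk
  have hkpos : 0 < k := div_pos Real.pi_pos hrl
  have hkr : k * (r - l) = Real.pi := div_mul_cancel₀ _ hrl.ne'
  set ε : ℝ := Φ 1 - Φ m with hε
  have hεpos : 0 < ε := sub_pos.2 (hΦ hmI h1I hm1)
  set Λ : ℝ := A * k ^ 2 + 1 with hΛ
  have hΛpos : 0 < Λ := by positivity
  set E : ℝ → ℝ := fun t => Real.exp (-Λ * (t - s)) with hE
  have hEpos : ∀ t, 0 < E t := fun t => Real.exp_pos _
  have hEle : ∀ t, s ≤ t → E t ≤ 1 := fun t ht => by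
    rw [hE]
    refine Real.exp_le_one_iff.2 ?_
    nlinarith
  have hEdec : ∀ τ t, E t * Λ * (t - τ) ≤ E τ - E t := fun τ t => by
    have h1 : E τ = E t * Real.exp (Λ * (t - τ)) := by
      simp only [hE, ← Real.exp_add]; ring_nf
    have h2 := mul_le_mul_of_nonneg_left (Real.add_one_le_exp (Λ * (t - τ))) (hEpos t).le
    rw [h1]; linarith
  have hθ : ∀ x ∈ Icc l r, k * (x - l) ∈ Icc 0 Real.pi := fun x hx =>
    ⟨mul_nonneg hkpos.le (sub_nonneg.2 hx.1), hkr ▸ by gcongr; exact hx.2⟩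
  have hsin : ∀ x ∈ Icc l r, 0 ≤ Real.sin (k * (x - l)) := fun x hx =>
    Real.sin_nonneg_of_mem_Icc (hθ x hx)
  set V : ℝ → ℝ → ℝ := fun x t => Φ 1 - ε * E t * Real.sin (k * (x - l)) with hVdef
  have hq : ∀ x ∈ Icc l r, ∀ t, s ≤ t → g (V x t) ∈ Icc m 1 ∧ Φ (g (V x t)) = V x t := by
    intro x hx t ht
    have h0 : 0 ≤ ε * E t * Real.sin (k * (x - l)) :=
      mul_nonneg (mul_nonneg hεpos.le (hEpos t).le) (hsin x hx)
    have h1 : ε * E t * Real.sin (k * (x - l)) ≤ ε * 1 * 1 := by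
      gcongr
      · exact hsin x hx
      · exact hEle t ht
      · exact Real.sin_le_one _
    obtain ⟨σ, hσ, hσV⟩ := intermediate_value_Icc hm1.le
      (hΦc.mono (Icc_subset_Icc_left hm0.le))
      (show V x t ∈ Icc (Φ m) (Φ 1) from ⟨by simp only [hVdef]; linarith,
        by simp only [hVdef]; linarith⟩)
    rw [← hσV, hg σ ⟨hm0.le.trans hσ.1, hσ.2⟩]
    exact ⟨hσ, rfl⟩
  have hq01 : ∀ x ∈ Icc l r, ∀ t, s ≤ t → g (V x t) ∈ Icc (0 : ℝ) 1 := fun x hx t ht =>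
    Icc_subset_Icc_left hm0.le (hq x hx t ht).1
  have hVc : Continuous fun z : ℝ × ℝ => V z.1 z.2 := by fun_prop
  have hcmp := h.slope_le_of_supersolution hΦ hl hr hs hst ht₁ hp
    (q := fun x t => g (V x t)) (Vx := fun x t => -(ε * E t * k * Real.cos (k * (x - l))))
    (hgc.comp hVc) (fun x hx t ht => hm0.trans_le (hq x hx t ht.1).1.1)
    (fun t _ => by simp [hVdef, hg 1 h1I]) (fun t _ => by simp [hVdef, hkr, hg 1 h1I])
    (fun x hx t ht => ?_) (fun x y hlx hxy hyr t ht => ?_)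
    (fun x hx => (hm x hx).trans (hq x hx s le_rfl).1.1)
  · refine ⟨ε * E t₁, mul_pos hεpos (hEpos _), fun x hx => ?_⟩
    have h1 := hcmp x hx t₁ (right_mem_Icc.2 hst.le)
    have h2 := (hq x hx t₁ hst.le)
    refine ⟨h1.trans h2.1.2, fun h0 => ?_⟩
    have h3 := hΦ.monotoneOn ⟨h0, h1.trans h2.1.2⟩ (hq01 x hx t₁ hst.le) h1
    rwa [h2.2] at h3
  · have hd : HasDerivAt (fun y => V y t) (-(ε * E t * k * Real.cos (k * (x - l)))) x := by
      have h1 := ((((hasDerivAt_id x).sub_const l).const_mul k).sin.const_mul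
        (ε * E t)).const_sub (Φ 1)
      refine h1.congr_deriv ?_
      simp only [id]; ring
    refine hd.congr_of_eventuallyEq ?_
    filter_upwards [Ioo_mem_nhds hx.1 hx.2] with z hz
    exact (hq z (Ioo_subset_Icc_self hz) t ht.1).2
  · set C : ℝ := Real.cos (k * (x - l)) - Real.cos (k * (y - l)) with hC
    have hxyI : ∀ ξ ∈ Icc x y, ξ ∈ Icc l r := fun ξ hξ =>
      ⟨hlx.le.trans hξ.1, hξ.2.trans hyr.le⟩
    have hCpos : 0 < C := sub_pos.2 (Real.strictAntiOn_cos
      (hθ x (hxyI x (left_mem_Icc.2 hxy.le))) (hθ y (hxyI y (right_mem_Icc.2 hxy.le)))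
      (by gcongr))
    refine ⟨ε * C * E t * Λ / (A * k), ?_, ?_⟩
    · rw [lt_div_iff₀ (by positivity)]
      have h1 : 0 < ε * C * E t := mul_pos (mul_pos hεpos hCpos) (hEpos t)
      have h2 : (-(ε * E t * k * Real.cos (k * (y - l))) -
          -(ε * E t * k * Real.cos (k * (x - l)))) * (A * k) = ε * C * E t * (A * k ^ 2) := by
        rw [hC]; ring
      rw [h2]
      gcongr
      rw [hΛ]; linarith
    · filter_upwards [Ioo_mem_nhdsLT ht.1] with τ hτ
      have hqc : ∀ t, Continuous fun ξ => g (V ξ t) := fun t =>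
        hgc.comp (hVc.comp (by fun_prop : Continuous fun ξ : ℝ => (ξ, t)))
      have hint : ∫ ξ in x..y, Real.sin (k * (ξ - l)) = C / k := by
        have h1 : ∀ ξ, k * (ξ - l) = k * ξ - k * l := fun ξ => by ring
        simp_rw [h1]
        rw [intervalIntegral.integral_comp_mul_sub Real.sin hkpos.ne', integral_sin, hC, h1, h1,
          smul_eq_mul]
        ring
      calc ε * C * E t * Λ / (A * k) * (t - τ)
          = ε * C / (A * k) * (E t * Λ * (t - τ)) := by ring
        _ ≤ ε * C / (A * k) * (E τ - E t) := by
          gcongr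
          exact hEdec τ t
        _ = ∫ ξ in x..y, ε * (E τ - E t) / A * Real.sin (k * (ξ - l)) := by
          rw [intervalIntegral.integral_const_mul, hint]
          field_simp
        _ ≤ ∫ ξ in x..y, (g (V ξ t) - g (V ξ τ)) := by
          refine intervalIntegral.integral_mono_on hxy.le
            (Continuous.intervalIntegrable (by fun_prop) _ _)
            (((hqc t).sub (hqc τ)).intervalIntegrable _ _) fun ξ hξ => ?_
          have hξ' := hxyI ξ hξ
          have hEτ : 0 ≤ E τ - E t := (by
            have := mul_nonneg (mul_pos (hEpos t) hΛpos).le (sub_nonneg.2 hτ.2.le)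
            exact this.trans (hEdec τ t))
          have hVV : V ξ t - V ξ τ = ε * (E τ - E t) * Real.sin (k * (ξ - l)) := by
            simp only [hVdef]; ring
          have hVle : V ξ τ ≤ V ξ t := by
            rw [← sub_nonneg, hVV]
            exact mul_nonneg (mul_nonneg hεpos.le hEτ) (hsin ξ hξ')
          have hqτ := hq01 ξ hξ' τ hτ.1.le
          have hqt := hq01 ξ hξ' t ht.1.le
          have hle : g (V ξ τ) ≤ g (V ξ t) := by
            rw [← hΦ.le_iff_le hqτ hqt, (hq ξ hξ' τ hτ.1.le).2, (hq ξ hξ' t ht.1.le).2]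
            exact hVle
          have h3 := hΦA _ hqτ _ hqt hle
          rw [(hq ξ hξ' τ hτ.1.le).2, (hq ξ hξ' t ht.1.le).2, hVV] at h3
          rw [div_mul_eq_mul_div, div_le_iff₀ hA]
          linarith

/-- If the slope is below `1` at some point, it remains so at all later times. -/
theorem slope_lt_one (h : IsClassicalSolution Φ x₁ x₂ T u p w)
    (hΦc : ContinuousOn Φ (Icc 0 1)) (hΦ : StrictMonoOn Φ (Icc 0 1))
    (hΦmax : ∀ σ, 0 ≤ σ → Φ σ ≤ Φ 1) {A : ℝ} (hA : 0 < A)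
    (hΦA : ∀ a ∈ Icc (0 : ℝ) 1, ∀ b ∈ Icc (0 : ℝ) 1, a ≤ b → Φ b - Φ a ≤ A * (b - a))
    {s t x₀ : ℝ} (hs : 0 ≤ s) (hst : s ≤ t) (ht : t < T) (hx₀ : x₀ ∈ Ioo x₁ x₂)
    (hp : p x₀ s < 1) : p x₀ t < 1 := by
  by_contra! hcontra
  obtain ⟨δ, hδ, hball⟩ := Metric.nhds_basis_closedBall.eventually_iff.1
    (((h.continuousAt_slope_space hx₀ ⟨hs, hst.trans_lt ht⟩).eventually_lt
      continuousAt_const hp).and (Ioo_mem_nhds hx₀.1 hx₀.2))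
  rw [Real.closedBall_eq_Icc] at hball
  set α := x₀ - δ
  set β := x₀ + δ
  have hI : ∀ x ∈ Icc α β, x ∈ Ioo x₁ x₂ := fun x hx => (hball hx).2
  have hαβ : α < β := by simp only [α, β]; linarith
  have hpc : ContinuousOn (fun z : ℝ × ℝ => p z.1 z.2) (Icc α β ×ˢ Icc s t) :=
    h.continuousOn_slope.mono
      (prod_mono hI fun τ hτ => ⟨hs.trans hτ.1, hτ.2.trans_lt ht⟩)
  have hcpt : IsCompact ((Icc α β ×ˢ Icc s t) ∩ (fun z : ℝ × ℝ => p z.1 z.2) ⁻¹' Ici 1) :=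
    (isCompact_Icc.prod isCompact_Icc).of_isClosed_subset
      (hpc.preimage_isClosed_of_isClosed (isClosed_Icc.prod isClosed_Icc) isClosed_Ici)
      inter_subset_left
  -- the first time `t₁` at which the slope reaches `1`, at a point `c`
  obtain ⟨⟨c, t₁⟩, ⟨⟨hc, ht₁⟩, hct⟩, hmin⟩ := hcpt.exists_isMinOn (f := Prod.snd)
    ⟨(x₀, t), ⟨⟨⟨by simp only [α]; linarith, by simp only [β]; linarith⟩,
      right_mem_Icc.2 hst⟩, hcontra⟩⟩ continuous_snd.continuousOn
  change c ∈ Icc α β at hc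
  change t₁ ∈ Icc s t at ht₁
  change 1 ≤ p c t₁ at hct
  have hbefore : ∀ x ∈ Icc α β, ∀ τ ∈ Ico s t₁, p x τ < 1 := by
    intro x hx τ hτ
    by_contra! hx1
    exact hτ.2.not_ge (hmin (show (x, τ) ∈ _ from ⟨⟨hx, ⟨hτ.1, hτ.2.le.trans ht₁.2⟩⟩, hx1⟩))
  have hst₁ : s < t₁ := ht₁.1.lt_of_ne fun hE => by
    have := (hball hc).1
    rw [hE] at this
    exact hct.not_gt this
  have ht₁T : t₁ ∈ Ico 0 T := ⟨hs.trans ht₁.1, ht₁.2.trans_lt ht⟩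
  have hflux := h.hasDerivAt_flux c (hI c hc) t₁ ht₁T
  have hnonneg : ∀ᶠ ξ in 𝓝 c, 0 < p ξ t₁ :=
    continuousAt_const.eventually_lt (h.continuousAt_slope_space (hI c hc) ht₁T)
      (zero_lt_one.trans_le hct)
  have hw : p c t₁ ≤ 1 → w c t₁ = 0 := by
    intro hc1
    refine IsLocalMax.hasDerivAt_eq_zero (f := fun y => Φ (p y t₁)) ?_ hflux
    filter_upwards [hnonneg] with ξ hξ
    simp only [le_antisymm hc1 hct]
    exact hΦmax _ hξ.le
  have hbarrier : ∀ k ε l : ℝ, HasDerivAt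
      (fun y => Φ (p y t₁) - (Φ 1 - ε * Real.sin (k * (y - l))))
      (w c t₁ + ε * (Real.cos (k * (c - l)) * k)) c := fun k ε l => by
    have h1 := ((((hasDerivAt_id c).sub_const l).const_mul k).sin.const_mul ε).const_sub (Φ 1)
    exact (hflux.sub h1).congr_deriv (by simp)
  -- Hopf's lemma on an interval ending at `c` contradicts `w c t₁ = 0`
  rcases hc.2.lt_or_eq with hcβ | hcβ
  · have hsub : Icc c β ⊆ Icc α β := Icc_subset_Icc_left hc.1
    obtain ⟨ε, hε, H⟩ := h.exists_flux_le_sub_sin hΦc hΦ hA hΦA (hI c hc).1 hcβ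
      (hI β (right_mem_Icc.2 hαβ.le)).2 hs hst₁ ht₁T.2 fun x hx => hbefore x (hsub hx)
    have hc1 := (H c (left_mem_Icc.2 hcβ.le)).1
    have hk : 0 < Real.pi / (β - c) := div_pos Real.pi_pos (sub_pos.2 hcβ)
    have hd := (hbarrier (Real.pi / (β - c)) ε c).eventually_nhdsGT_lt (by
      rw [hw hc1, sub_self, mul_zero, Real.cos_zero]; positivity)
    obtain ⟨ξ, ⟨hξ1, hξ2⟩, hξI⟩ :=
      ((hd.and (nhdsWithin_le_nhds hnonneg)).and (Ioo_mem_nhdsGT hcβ)).exists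
    have hξ := (H ξ (Ioo_subset_Icc_self hξI)).2 hξ2.le
    simp only [le_antisymm hc1 hct, sub_self, mul_zero, Real.sin_zero, sub_zero] at hξ1
    linarith
  · have hαc : α < c := hcβ ▸ hαβ
    have hsub : Icc α c ⊆ Icc α β := Icc_subset_Icc_right hc.2
    obtain ⟨ε, hε, H⟩ := h.exists_flux_le_sub_sin hΦc hΦ hA hΦA
      (hI α (left_mem_Icc.2 hαβ.le)).1 hαc (hI c hc).2 hs hst₁ ht₁T.2
      fun x hx => hbefore x (hsub hx)
    have hc1 := (H c (right_mem_Icc.2 hαc.le)).1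
    have hk : 0 < Real.pi / (c - α) := div_pos Real.pi_pos (sub_pos.2 hαc)
    have hkc : Real.pi / (c - α) * (c - α) = Real.pi :=
      div_mul_cancel₀ _ (sub_pos.2 hαc).ne'
    have hd := (hbarrier (Real.pi / (c - α)) ε α).neg.eventually_nhdsLT_lt (by
      rw [hw hc1, hkc, Real.cos_pi]
      have := mul_pos hε hk
      linarith)
    obtain ⟨ξ, ⟨hξ1, hξ2⟩, hξI⟩ :=
      ((hd.and (nhdsWithin_le_nhds hnonneg)).and (Ioo_mem_nhdsLT hαc)).exists
    have hξ := (H ξ (Ioo_subset_Icc_self hξI)).2 hξ2.le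
    simp only [Pi.neg_apply, le_antisymm hc1 hct, hkc, Real.sin_pi, mul_zero, sub_zero,
      sub_self] at hξ1
    linarith

/-- If `Φ` is odd, reflecting a classical solution gives a classical solution. -/
theorem neg (h : IsClassicalSolution Φ x₁ x₂ T u p w) (hodd : ∀ σ, Φ (-σ) = -Φ σ) :
    IsClassicalSolution Φ x₁ x₂ T (fun x t => -u x t) (fun x t => -p x t)
      (fun x t => -w x t) where
  hasDerivAt_space x hx t ht := (h.hasDerivAt_space x hx t ht).neg
  hasDerivWithinAt_time x hx t ht := (h.hasDerivWithinAt_time x hx t ht).neg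
  continuousOn := h.continuousOn.neg
  continuousOn_slope := h.continuousOn_slope.neg
  hasDerivAt_flux x hx t ht := by
    simp only [hodd]
    exact (h.hasDerivAt_flux x hx t ht).neg

end IsClassicalSolution

end ClassicalSolution


/-- In dimension one, subcritical regions of a `C¹` classical solution of
`u_t = (φ'(u_x))_x` on `(x₁,x₂)×[0,T)` do not shrink: if `|u_x(x₀,s)| < 1`
and `s ≤ t < T`, then `|u_x(x₀,t)| < 1`. -/
theorem subcritical_region_nondecreasing_dim_one
    (φ : ℝ → ℝ) (hφ : ContDiff ℝ (⊤ : ℕ∞) φ) (hφeven : ∀ σ : ℝ, φ (-σ) = φ σ)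
    (hφ2pos : ∀ σ : ℝ, 0 ≤ σ → σ < 1 → 0 < deriv (deriv φ) σ)
    (hφ2one : deriv (deriv φ) 1 = 0)
    (hφ2neg : ∀ σ : ℝ, 1 < σ → deriv (deriv φ) σ < 0)
    (x₁ x₂ T : ℝ) (h12 : x₁ < x₂) (hT : 0 < T)
    (u ux ut : ℝ → ℝ → ℝ)
    -- `u` is of class `C¹` on `(x₁,x₂)×[0,T)`: the partial derivatives exist ...
    (hux : ∀ x t : ℝ, x ∈ Set.Ioo x₁ x₂ → t ∈ Set.Ico 0 T →
      HasDerivAt (fun y => u y t) (ux x t) x)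
    (hut : ∀ x t : ℝ, x ∈ Set.Ioo x₁ x₂ → t ∈ Set.Ico 0 T →
      HasDerivWithinAt (fun s => u x s) (ut x t) (Set.Ico 0 T) t)
    -- ... and `u`, `u_x`, `u_t` are continuous on `(x₁,x₂)×[0,T)`
    (huC : ContinuousOn (fun p : ℝ × ℝ => u p.1 p.2) (Set.Ioo x₁ x₂ ×ˢ Set.Ico 0 T))
    (huxC : ContinuousOn (fun p : ℝ × ℝ => ux p.1 p.2) (Set.Ioo x₁ x₂ ×ˢ Set.Ico 0 T))
    (hutC : ContinuousOn (fun p : ℝ × ℝ => ut p.1 p.2) (Set.Ioo x₁ x₂ ×ˢ Set.Ico 0 T))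
    -- the equation: `x ↦ φ'(u_x(x,t))` is differentiable and its derivative is `u_t(x,t)`
    (heq : ∀ x t : ℝ, x ∈ Set.Ioo x₁ x₂ → t ∈ Set.Ico 0 T →
      HasDerivAt (fun y => deriv φ (ux y t)) (ut x t) x) :
    ∀ s t : ℝ, 0 ≤ s → s ≤ t → t < T → ∀ x₀ ∈ Set.Ioo x₁ x₂,
      |ux x₀ s| < 1 → |ux x₀ t| < 1 := by
  have hΦ1 : ContDiff ℝ 1 (deriv φ) :=
    (contDiff_infty_iff_deriv.1 (by exact_mod_cast hφ)).2.of_le (by exact_mod_cast le_top)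
  have hΦd : Differentiable ℝ (deriv φ) := hΦ1.differentiable one_ne_zero
  have hΦc : Continuous (deriv φ) := hΦ1.continuous
  have hodd : ∀ σ, deriv φ (-σ) = -deriv φ σ := fun σ => by
    have h1 : deriv (fun τ => φ (-τ)) (-σ) = -deriv φ σ := by
      rw [deriv_comp_neg, neg_neg]
    simpa only [hφeven] using h1
  have hmono : StrictMonoOn (deriv φ) (Set.Icc 0 1) := by
    refine strictMonoOn_of_deriv_pos (convex_Icc 0 1) hΦc.continuousOn fun σ hσ => ?_
    rw [interior_Icc] at hσ
    exact hφ2pos σ hσ.1.le hσ.2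
  have hanti : AntitoneOn (deriv φ) (Set.Ici 1) := by
    refine antitoneOn_of_deriv_nonpos (convex_Ici 1) hΦc.continuousOn
      hΦd.differentiableOn fun σ hσ => ?_
    rw [interior_Ici] at hσ
    exact (hφ2neg σ hσ).le
  have hmax : ∀ σ, 0 ≤ σ → deriv φ σ ≤ deriv φ 1 := fun σ hσ => by
    rcases le_total σ 1 with h | h
    · exact hmono.monotoneOn ⟨hσ, h⟩ ⟨zero_le_one, le_rfl⟩ h
    · exact hanti Set.self_mem_Ici h h
  obtain ⟨A, hA⟩ := isCompact_Icc.bddAbove_image (K := Set.Icc (0 : ℝ) 1)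
    (hΦ1.continuous_deriv le_rfl).continuousOn
  have hApos : 0 < A := (hφ2pos 0 le_rfl zero_lt_one).trans_le
    (hA (Set.mem_image_of_mem _ (Set.left_mem_Icc.2 zero_le_one)))
  have hΦA : ∀ a ∈ Set.Icc (0 : ℝ) 1, ∀ b ∈ Set.Icc (0 : ℝ) 1, a ≤ b →
      deriv φ b - deriv φ a ≤ A * (b - a) :=
    (convex_Icc 0 1).image_sub_le_mul_sub_of_deriv_le hΦc.continuousOn hΦd.differentiableOn
      fun σ hσ => hA (Set.mem_image_of_mem _ (interior_subset hσ))
  have hsol : IsClassicalSolution (deriv φ) x₁ x₂ T u ux ut :=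
    ⟨fun x hx t ht => hux x t hx ht, fun x hx t ht => hut x t hx ht, huC, huxC,
      fun x hx t ht => heq x t hx ht⟩
  intro s t hs hst ht x₀ hx₀ hsub
  rw [abs_lt] at hsub ⊢
  have h1 := hsol.slope_lt_one hΦc.continuousOn hmono hmax hApos hΦA hs hst ht hx₀ hsub.2
  have h2 := (hsol.neg hodd).slope_lt_one hΦc.continuousOn hmono hmax hApos hΦA hs hst ht hx₀
    (neg_lt.1 hsub.1)
  exact ⟨neg_lt.1 h2, h1⟩
end
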